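/- arXiv:2206.05579 — 9 statements merged into one kernel-verified Lean document; each statement's English description precedes it below -/
import Mathlib

section
/- Fix an integer k ≥ 1 and a family F ⊆ 2^[k]∖{∅}. The ExhSearch algorithm processes a request sequence σ = (σ_1,…,σ_T) as follows: it maintains a phase-start index ℓ (initially 1) and configurations C_t (with C_0 arbitrary); at each time t, if C_{t−1} satisfies σ_t it sets C_t = C_{t−1}; otherwise, if some configuration satisfies all of σ_ℓ,…,σ_t, it lets C_t be any such configuration; otherwise it sets ℓ = t and lets C_t be any configuration satisfying σ_t. Then for every request sequence σ and every configuration sequence (C_0,C_1,…,C_T) consistent with these rules, the cost (number of retrievals) of this run is at most k·min(|F*|, mass(F))·(opt(σ) + 1). In particular, ExhSearch is k·min(|F*|, mass(F))-competitive for Slot-Heterogenous Paging with requestable-set family F. -/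
/-!
Slot-Heterogenous Paging: the ExhSearch algorithm is
`k * min(|F*|, mass(F))`-competitive.
-/

/-- A cache configuration: each of the `k` slots holds a page (`some p`) or is empty.
Pages are identified with natural numbers. -/
abbrev Config (k : ℕ) := Fin k → Option ℕ

/-- A request: a page together with a set of slots. -/
abbrev Request (k : ℕ) := ℕ × Finset (Fin k)

/-- A configuration satisfies a request if the requested page is in one of the
requested slots. -/
def Satisfies {k : ℕ} (C : Config k) (r : Request k) : Prop :=
  ∃ s ∈ r.2, C s = some r.1

/-- The cost (number of retrievals) of a configuration sequence over times `1..T`: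
the number of pairs `(t, s)` with `1 ≤ t ≤ T` such that slot `s` holds a page at
time `t` which it did not hold at time `t-1`. -/
def seqCost {k : ℕ} (C : ℕ → Config k) (T : ℕ) : ℕ :=
  ∑ t ∈ Finset.Icc 1 T,
    (Finset.univ.filter (fun s : Fin k => (C t s).isSome ∧ C t s ≠ C (t - 1) s)).card

/-- The optimal offline cost of a request sequence (over all initial configurations
`C 0` and all solutions). -/
noncomputable def optCost {k : ℕ} (σ : ℕ → Request k) (T : ℕ) : ℕ :=
  sInf { c | ∃ C : ℕ → Config k,
    (∀ t ∈ Finset.Icc 1 T, Satisfies (C t) (σ t)) ∧ c = seqCost C T }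

/-- `mass F = Σ_{S ∈ F} |S|`. -/
def mass {k : ℕ} (F : Finset (Finset (Fin k))) : ℕ := ∑ S ∈ F, S.card

/-- `F* = ∪_{S ∈ F} 2^S`, the family of all subsets of members of `F`. -/
def Fstar {k : ℕ} (F : Finset (Finset (Fin k))) : Finset (Finset (Fin k)) :=
  F.biUnion (fun S => S.powerset)

/-- A run of the ExhSearch algorithm on the request sequence `σ` over times `1..T`:
`C t` is the configuration after serving request `t` (with `C 0` arbitrary), and
`ℓ t` is the start of the current phase after serving request `t` (initially `1`).
If the previous configuration satisfies the current request, nothing changes;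
otherwise, if some configuration satisfies all requests of the current phase up to
and including the current one, any such configuration is chosen; otherwise a new
phase starts at the current time and any configuration satisfying the current
request is chosen. -/
def ExhSearchRun {k : ℕ} (σ : ℕ → Request k) (T : ℕ) (C : ℕ → Config k)
    (ℓ : ℕ → ℕ) : Prop :=
  ℓ 0 = 1 ∧
  ∀ t ∈ Finset.Icc 1 T,
    (Satisfies (C (t - 1)) (σ t) → C t = C (t - 1) ∧ ℓ t = ℓ (t - 1)) ∧
    (¬ Satisfies (C (t - 1)) (σ t) →
      ((∃ D : Config k, ∀ i ∈ Finset.Icc (ℓ (t - 1)) t, Satisfies D (σ i)) →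
        ℓ t = ℓ (t - 1) ∧ ∀ i ∈ Finset.Icc (ℓ (t - 1)) t, Satisfies (C t) (σ i)) ∧
      ((¬ ∃ D : Config k, ∀ i ∈ Finset.Icc (ℓ (t - 1)) t, Satisfies D (σ i)) →
        ℓ t = t ∧ Satisfies (C t) (σ t)))

/-- Numeric encoding of the content of a slot. -/
def slotVal (x : Option ℕ) : ℚ := x.elim 0 (fun p => (p : ℚ) + 1)

lemma slotVal_eq_iff (x : Option ℕ) (p : ℕ) : slotVal x - ((p : ℚ) + 1) = 0 ↔ x = some p := by
  cases x with
  | none =>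
    simp only [slotVal, Option.elim, reduceCtorEq, iff_false]
    have : (0 : ℚ) ≤ p := Nat.cast_nonneg p
    intro h
    linarith
  | some q =>
    simp only [slotVal, Option.elim, Option.some.injEq]
    constructor
    · intro h
      have : (q : ℚ) = p := by linarith
      exact_mod_cast this
    · rintro rfl
      ring

/-- The polynomial function that vanishes exactly on the configurations satisfying `r`. -/
def reqPoly {k : ℕ} (r : Request k) : Config k → ℚ :=
  fun C => ∏ s ∈ r.2, (slotVal (C s) - ((r.1 : ℚ) + 1))

/-- The multilinear monomial of a slot set. -/
def slotMono {k : ℕ} (A : Finset (Fin k)) : Config k → ℚ :=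
  fun C => ∏ s ∈ A, slotVal (C s)

lemma reqPoly_eq_zero_iff {k : ℕ} (r : Request k) (C : Config k) :
    reqPoly r C = 0 ↔ Satisfies C r := by
  unfold reqPoly Satisfies
  rw [Finset.prod_eq_zero_iff]
  simp only [slotVal_eq_iff]

lemma reqPoly_mem {k : ℕ} (F : Finset (Finset (Fin k))) (r : Request k) (hr : r.2 ∈ F) :
    reqPoly r ∈ Submodule.span ℚ (Set.range (fun A : Fstar F => slotMono A.1)) := by
  have : reqPoly r = ∑ t ∈ r.2.powerset, (∏ _i ∈ r.2 \ t, (-((r.1 : ℚ) + 1))) • slotMono t := by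
    funext C
    simp only [reqPoly, sub_eq_add_neg, Finset.prod_add, Finset.sum_apply, Pi.smul_apply,
      slotMono, smul_eq_mul]
    refine Finset.sum_congr rfl fun t _ => mul_comm _ _
  rw [this]
  refine Submodule.sum_mem _ fun t ht => Submodule.smul_mem _ _ (Submodule.subset_span ?_)
  exact ⟨⟨t, Finset.mem_biUnion.2 ⟨r.2, hr, ht⟩⟩, rfl⟩

lemma card_le_Fstar {k : ℕ} (F : Finset (Finset (Fin k))) (B : Finset ℕ)
    (r : ℕ → Request k) (E : ℕ → Config k) (hr : ∀ t ∈ B, (r t).2 ∈ F)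
    (h1 : ∀ t ∈ B, ¬ Satisfies (E t) (r t))
    (h2 : ∀ t ∈ B, ∀ j ∈ B, j < t → Satisfies (E t) (r j)) :
    B.card ≤ (Fstar F).card := by
  classical
  have hli : LinearIndependent ℚ (fun t : B => reqPoly (r t.1)) := by
    rw [Fintype.linearIndependent_iff]
    intro g hg
    by_contra hne
    push Not at hne
    obtain ⟨i0, hi0⟩ := hne
    obtain ⟨i, hi, hmax⟩ := Finset.exists_max_image
      (Finset.univ.filter (fun i : B => g i ≠ 0)) (fun i => i.1) ⟨i0, by simp [hi0]⟩
    have hgi : g i ≠ 0 := by simpa using hi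
    have hev := congrFun hg (E i.1)
    simp only [Finset.sum_apply, Pi.smul_apply, smul_eq_mul, Pi.zero_apply] at hev
    rw [Finset.sum_eq_single i] at hev
    · rcases mul_eq_zero.1 hev with h | h
      · exact hgi h
      · exact h1 i.1 i.2 ((reqPoly_eq_zero_iff _ _).1 h)
    · intro j _ hji
      by_cases hgj : g j = 0
      · simp [hgj]
      · have hle := hmax j (by simp [hgj])
        have hlt : j.1 < i.1 := lt_of_le_of_ne hle (fun h => hji (Subtype.ext h))
        rw [(reqPoly_eq_zero_iff _ _).2 (h2 i.1 i.2 j.1 j.2 hlt), mul_zero]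
    · intro h
      exact absurd (Finset.mem_univ i) h
  have := linearIndependent_le_span_aux' _ hli
    (Set.range (fun A : Fstar F => slotMono A.1)) (by
      rintro _ ⟨t, rfl⟩
      exact reqPoly_mem F _ (hr t.1 t.2))
  have h3 := Fintype.card_range_le (fun A : Fstar F => slotMono A.1)
  simp only [Fintype.card_coe] at this h3
  exact this.trans h3

lemma card_le_mass {k : ℕ} (F : Finset (Finset (Fin k))) (B : Finset ℕ)
    (r : ℕ → Request k) (E : ℕ → Config k) (hr : ∀ t ∈ B, (r t).2 ∈ F)
    (h1 : ∀ t ∈ B, ¬ Satisfies (E t) (r t))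
    (h2 : ∀ t ∈ B, ∀ j ∈ B, j < t → Satisfies (E t) (r j))
    (D : Config k) (hD : ∀ t ∈ B, Satisfies D (r t)) :
    B.card ≤ mass F := by
  classical
  have hinj : ∀ i ∈ B, ∀ j ∈ B, r i = r j → i = j := by
    intro i hi j hj hij
    rcases lt_trichotomy i j with h | h | h
    · exact absurd (hij ▸ h2 j hj i hi h) (h1 j hj)
    · exact h
    · exact absurd (hij ▸ h2 i hi j hj h) (h1 i hi)
  have hex : ∀ t : B, ∃ s, s ∈ (r t.1).2 ∧ D s = some (r t.1).1 := by
    intro t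
    obtain ⟨s, hs, h⟩ := hD t.1 t.2
    exact ⟨s, hs, h⟩
  choose f hf1 hf2 using hex
  have hm : mass F = (F.sigma (fun S => S)).card := by
    simp [mass, Finset.card_sigma]
  rw [hm, ← Finset.card_attach]
  refine Finset.card_le_card_of_injOn (fun t => (⟨(r t.1).2, f t⟩ : Σ _ : Finset (Fin k), Fin k))
    ?_ ?_
  · intro t _
    simp only [Finset.coe_sigma, Set.mem_sigma_iff, Finset.mem_coe]
    exact ⟨hr t.1 t.2, hf1 t⟩
  · intro a _ b _ hab
    simp only [Sigma.mk.injEq, heq_eq_eq] at hab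
    apply Subtype.ext
    apply hinj a.1 a.2 b.1 b.2
    refine Prod.ext ?_ hab.1
    have h := hf2 a
    rw [hab.2, hf2 b] at h
    exact (Option.some.inj h).symm

lemma seqCost_succ {k : ℕ} (C : ℕ → Config k) (t : ℕ) :
    seqCost C (t + 1) = seqCost C t +
      (Finset.univ.filter (fun s : Fin k => (C (t + 1) s).isSome ∧ C (t + 1) s ≠ C t s)).card := by
  unfold seqCost
  rw [Finset.sum_Icc_succ_top (by omega)]
  simp

lemma seqCost_mono {k : ℕ} (C : ℕ → Config k) : Monotone (seqCost C) :=
  monotone_nat_of_le_succ fun t => by rw [seqCost_succ]; omega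

lemma seqCost_const {k : ℕ} (D : ℕ → Config k) (a n : ℕ)
    (h : seqCost D (a + n) = seqCost D a) (s : Fin k) (p : ℕ)
    (hp : D (a + n) s = some p) : D a s = some p := by
  induction n with
  | zero => exact hp
  | succ n ih =>
    have e1 := seqCost_succ D (a + n)
    have e2 : seqCost D a ≤ seqCost D (a + n) := seqCost_mono D (by omega)
    rw [← add_assoc] at h hp
    have h0 : (Finset.univ.filter (fun s : Fin k =>
        (D (a + n + 1) s).isSome ∧ D (a + n + 1) s ≠ D (a + n) s)).card = 0 := by omega
    apply ih (by omega)
    rw [Finset.card_eq_zero, Finset.filter_eq_empty_iff] at h0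
    have h3 := h0 (Finset.mem_univ s)
    rw [hp] at h3
    simp only [Option.isSome_some, true_and, ne_eq, not_not] at h3
    exact h3.symm

/-- Basic invariants of a run. -/
lemma run_inv {k : ℕ} {σ : ℕ → Request k} {T : ℕ} {C : ℕ → Config k} {ℓ : ℕ → ℕ}
    (hrun : ExhSearchRun σ T C ℓ) (t : ℕ) (ht : t ≤ T) :
    1 ≤ ℓ t ∧ ℓ t ≤ max t 1 ∧ ∀ i ∈ Finset.Icc (ℓ t) t, Satisfies (C t) (σ i) := by
  induction t with
  | zero =>
    rw [hrun.1]
    simp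
  | succ t ih =>
    obtain ⟨a, b, c⟩ := ih (by omega)
    obtain ⟨r1, r2⟩ := hrun.2 (t + 1) (Finset.mem_Icc.2 ⟨by omega, ht⟩)
    simp only [Nat.add_sub_cancel] at r1 r2
    by_cases hs : Satisfies (C t) (σ (t + 1))
    · obtain ⟨e1, e2⟩ := r1 hs
      rw [e1, e2]
      refine ⟨a, by omega, fun i hi => ?_⟩
      rw [Finset.mem_Icc] at hi
      rcases Nat.lt_or_ge t i with h | h
      · obtain rfl : i = t + 1 := by omega
        exact hs
      · exact c i (Finset.mem_Icc.2 ⟨hi.1, h⟩)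
    · by_cases hD : ∃ D : Config k, ∀ i ∈ Finset.Icc (ℓ t) (t + 1), Satisfies D (σ i)
      · obtain ⟨e1, e2⟩ := (r2 hs).1 hD
        rw [e1]
        exact ⟨a, by omega, e2⟩
      · obtain ⟨e1, e2⟩ := (r2 hs).2 hD
        rw [e1]
        refine ⟨by omega, by omega, fun i hi => ?_⟩
        rw [Finset.mem_Icc] at hi
        obtain rfl : i = t + 1 := by omega
        exact e2

lemma run_step {k : ℕ} {σ : ℕ → Request k} {T : ℕ} {C : ℕ → Config k} {ℓ : ℕ → ℕ}
    (hrun : ExhSearchRun σ T C ℓ) (t : ℕ) (ht : t + 1 ≤ T) :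
    ℓ (t + 1) = ℓ t ∨ (ℓ (t + 1) = t + 1 ∧
      ¬ ∃ D : Config k, ∀ i ∈ Finset.Icc (ℓ t) (t + 1), Satisfies D (σ i)) := by
  obtain ⟨r1, r2⟩ := hrun.2 (t + 1) (Finset.mem_Icc.2 ⟨by omega, ht⟩)
  simp only [Nat.add_sub_cancel] at r1 r2
  by_cases hs : Satisfies (C t) (σ (t + 1))
  · exact Or.inl (r1 hs).2
  · by_cases hD : ∃ D : Config k, ∀ i ∈ Finset.Icc (ℓ t) (t + 1), Satisfies D (σ i)
    · exact Or.inl ((r2 hs).1 hD).1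
    · exact Or.inr ⟨((r2 hs).2 hD).1, hD⟩

lemma run_mono {k : ℕ} {σ : ℕ → Request k} {T : ℕ} {C : ℕ → Config k} {ℓ : ℕ → ℕ}
    (hrun : ExhSearchRun σ T C ℓ) (a n : ℕ) (h : a + n ≤ T) : ℓ a ≤ ℓ (a + n) := by
  induction n with
  | zero => exact le_rfl
  | succ n ih =>
    have h1 := ih (by omega)
    have h2 := (run_inv hrun (a + n) (by omega)).2.1
    rcases run_step hrun (a + n) (by omega) with h3 | ⟨h3, _⟩
    · rw [← add_assoc]
      omega
    · rw [← add_assoc]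
      omega

lemma phases_le {k : ℕ} {σ : ℕ → Request k} {T : ℕ} {C : ℕ → Config k} {ℓ : ℕ → ℕ}
    (hrun : ExhSearchRun σ T C ℓ) (D : ℕ → Config k)
    (hD : ∀ t ∈ Finset.Icc 1 T, Satisfies (D t) (σ t)) (t : ℕ) (ht : t ≤ T) :
    ((Finset.range (t + 1)).image ℓ).card ≤ seqCost D (ℓ t) + 1 := by
  induction t with
  | zero => simp
  | succ t ih =>
    have ih := ih (by omega)
    have hmem : ℓ t ∈ (Finset.range (t + 1)).image ℓ :=
      Finset.mem_image_of_mem _ (by simp)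
    rw [Finset.range_add_one, Finset.image_insert]
    rcases run_step hrun t ht with h | ⟨h, hno⟩
    · rw [h, Finset.insert_eq_of_mem hmem]
      exact ih
    · obtain ⟨a, b, -⟩ := run_inv hrun t (by omega)
      have hle : ℓ t ≤ t + 1 := by omega
      have hlt : seqCost D (ℓ t) < seqCost D (t + 1) := by
        refine lt_of_le_of_ne (seqCost_mono D hle) fun he => hno ⟨D (ℓ t), fun i hi => ?_⟩
        rw [Finset.mem_Icc] at hi
        obtain ⟨s, hs, hp⟩ := hD i (Finset.mem_Icc.2 ⟨by omega, by omega⟩)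
        refine ⟨s, hs, ?_⟩
        have e1 : seqCost D (ℓ t) ≤ seqCost D i := seqCost_mono D hi.1
        have e2 : seqCost D i ≤ seqCost D (t + 1) := seqCost_mono D hi.2
        have e3 : ℓ t + (i - ℓ t) = i := by omega
        exact seqCost_const D (ℓ t) (i - ℓ t) (by rw [e3]; omega) s _ (by rw [e3]; exact hp)
      have := Finset.card_insert_le (ℓ (t + 1)) ((Finset.range (t + 1)).image ℓ)
      rw [h] at this ⊢
      omega

lemma phase_faults_le {k : ℕ} (F : Finset (Finset (Fin k)))
    {σ : ℕ → Request k} {T : ℕ} (hσ : ∀ t ∈ Finset.Icc 1 T, (σ t).2 ∈ F)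
    {C : ℕ → Config k} {ℓ : ℕ → ℕ}
    (hrun : ExhSearchRun σ T C ℓ) (B : Finset ℕ) (v : ℕ)
    (hB : ∀ t ∈ B, (1 ≤ t ∧ t ≤ T) ∧ ¬ Satisfies (C (t - 1)) (σ t) ∧ ℓ t = v) :
    B.card ≤ min (Fstar F).card (mass F) := by
  have hr : ∀ t ∈ B, (σ t).2 ∈ F := fun t ht => hσ t (Finset.mem_Icc.2 (hB t ht).1)
  have h1 : ∀ t ∈ B, ¬ Satisfies (C (t - 1)) (σ t) := fun t ht => (hB t ht).2.1
  have h2 : ∀ t ∈ B, ∀ j ∈ B, j < t → Satisfies (C (t - 1)) (σ j) := by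
    intro t ht j hj hjt
    obtain ⟨⟨a1, a2⟩, -, a3⟩ := hB t ht
    obtain ⟨⟨b1, b2⟩, -, b3⟩ := hB j hj
    have m1 := run_mono hrun j (t - 1 - j) (by omega)
    have m2 := run_mono hrun (t - 1) 1 (by omega)
    rw [show j + (t - 1 - j) = t - 1 by omega] at m1
    rw [show t - 1 + 1 = t by omega] at m2
    have m3 := (run_inv hrun j b2).2.1
    exact (run_inv hrun (t - 1) (by omega)).2.2 j (Finset.mem_Icc.2 ⟨by omega, by omega⟩)
  refine le_min (card_le_Fstar F B σ (fun t => C (t - 1)) hr h1 h2) ?_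
  rcases B.eq_empty_or_nonempty with rfl | hne
  · simp
  · obtain ⟨m, hm, hmax⟩ := Finset.exists_max_image B id hne
    refine card_le_mass F B σ (fun t => C (t - 1)) hr h1 h2 (C m) fun t ht => ?_
    obtain ⟨⟨a1, a2⟩, -, a3⟩ := hB t ht
    obtain ⟨⟨b1, b2⟩, -, b3⟩ := hB m hm
    have m3 := (run_inv hrun t a2).2.1
    have m4 : t ≤ m := hmax t ht
    exact (run_inv hrun m b2).2.2 t (Finset.mem_Icc.2 ⟨by omega, m4⟩)

/-- **Theorem (ExhSearch upper bound).** For any family `F ⊆ 2^[k] \ {∅}` of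
requestable slot sets, any request sequence `σ` with all requested slot sets in
`F`, and any run of ExhSearch on `σ`, the cost of the run is at most
`k * min(|F*|, mass(F)) * (opt(σ) + 1)`. -/
theorem exhSearch_competitive {k : ℕ} (hk : 1 ≤ k)
    (F : Finset (Finset (Fin k))) (hF : ∅ ∉ F)
    (σ : ℕ → Request k) (T : ℕ)
    (hσ : ∀ t ∈ Finset.Icc 1 T, (σ t).2 ∈ F)
    (C : ℕ → Config k) (ℓ : ℕ → ℕ)
    (hrun : ExhSearchRun σ T C ℓ) :
    seqCost C T ≤ k * min (Fstar F).card (mass F) * (optCost σ T + 1) := by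
  classical
  -- an optimal solution
  have hne : { c | ∃ C : ℕ → Config k,
      (∀ t ∈ Finset.Icc 1 T, Satisfies (C t) (σ t)) ∧ c = seqCost C T }.Nonempty := by
    refine ⟨_, fun t _ => some (σ t).1, fun t ht => ?_, rfl⟩
    have hS : (σ t).2.Nonempty := by
      rw [Finset.nonempty_iff_ne_empty]
      intro h
      exact hF (h ▸ hσ t ht)
    obtain ⟨s, hs⟩ := hS
    exact ⟨s, hs, rfl⟩
  obtain ⟨D, hD, hopt⟩ := Nat.sInf_mem hne
  change optCost σ T = seqCost D T at hopt
  rcases Nat.eq_zero_or_pos T with rfl | hT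
  · simp [seqCost]
  set M := min (Fstar F).card (mass F) with hM
  set A := (Finset.Icc 1 T).filter (fun t => ¬ Satisfies (C (t - 1)) (σ t)) with hA
  have hcost : seqCost C T ≤ A.card * k := by
    unfold seqCost
    rw [← Finset.sum_subset (Finset.filter_subset _ _ : A ⊆ Finset.Icc 1 T)]
    · rw [← smul_eq_mul]
      refine Finset.sum_le_card_nsmul _ _ _ fun t _ => ?_
      exact (Finset.card_le_univ _).trans (by simp)
    · intro t ht htA
      have hs : Satisfies (C (t - 1)) (σ t) := by
        by_contra h
        exact htA (Finset.mem_filter.2 ⟨ht, h⟩)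
      rw [((hrun.2 t ht).1 hs).1]
      simp
  have hAcard : A.card ≤ M * (A.image ℓ).card := by
    refine Finset.card_le_mul_card_image A M fun v _ => ?_
    refine phase_faults_le F hσ hrun _ v fun t ht => ?_
    simp only [hA, Finset.mem_filter, Finset.mem_Icc] at ht
    exact ⟨ht.1.1, ht.1.2, ht.2⟩
  have himg : (A.image ℓ).card ≤ optCost σ T + 1 := by
    have h1 : A.image ℓ ⊆ (Finset.range (T + 1)).image ℓ := by
      refine Finset.image_subset_image fun t ht => ?_
      simp only [hA, Finset.mem_filter, Finset.mem_Icc] at ht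
      exact Finset.mem_range.2 (by omega)
    have h2 := phases_le hrun D hD T le_rfl
    have h3 := (run_inv hrun T le_rfl).2.1
    have h4 : seqCost D (ℓ T) ≤ seqCost D T := seqCost_mono D (by omega)
    have h5 := Finset.card_le_card h1
    omega
  calc seqCost C T ≤ A.card * k := hcost
    _ ≤ (M * (optCost σ T + 1)) * k :=
      Nat.mul_le_mul_right _ (hAcard.trans (Nat.mul_le_mul_left _ himg))
    _ = k * M * (optCost σ T + 1) := by ring
end

section
/- Fix an integer k ≥ 1 and a finite family F ⊆ 2^[k]∖{∅}. Identify pages with real numbers, so that a cache configuration is a function [k] → ℝ. Let C_0, C_1, …, C_{L−1} : [k] → ℝ be configurations and (p_1,S_1),…,(p_L,S_L) be requests with p_t ∈ ℝ and S_t ∈ F, satisfying for every t ∈ {1,…,L}: (a) C_{t−1}(i) ≠ p_t for all i ∈ S_t, and (b) for every s < t there exists i ∈ S_s with C_{t−1}(i) = p_s. Then L ≤ |F*|, where F* = ∪_{S∈F} 2^S. -/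
/-!
The rank-method bound: an "upper-triangular" sequence of requests and real-valued
configurations has length at most `|F*|`.
-/

/-- **Theorem.** Fix `k ≥ 1` and a finite family `F ⊆ 2^[k] \ {∅}`. Identify pages
with real numbers, so a cache configuration is a function `Fin k → ℝ`. Suppose
`C 0, …, C (L-1)` are configurations (here `C t` plays the role of `C_{t-1}` for
the request with 0-based index `t`) and `(p t, S t)` for `t : Fin L` are requests
with `S t ∈ F`, such that for every `t`:
(a) `C t i ≠ p t` for all `i ∈ S t` (configuration `C_{t-1}` does not satisfy
request `t`), and
(b) for every `s < t` there is `i ∈ S s` with `C t i = p s` (configuration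
`C_{t-1}` satisfies every earlier request).
Then `L ≤ |F*|` where `F* = ∪_{S ∈ F} 2^S`. -/
theorem upper_triangular_length_le_Fstar {k : ℕ} (hk : 1 ≤ k)
    (F : Finset (Finset (Fin k))) (hF : ∅ ∉ F)
    (L : ℕ) (C : Fin L → Fin k → ℝ) (p : Fin L → ℝ) (S : Fin L → Finset (Fin k))
    (hS : ∀ t, S t ∈ F)
    (ha : ∀ t : Fin L, ∀ i ∈ S t, C t i ≠ p t)
    (hb : ∀ t s : Fin L, s < t → ∃ i ∈ S s, C t i = p s) :
    L ≤ (F.biUnion fun A => A.powerset).card := by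
  classical
  set G := F.biUnion fun A => A.powerset with hG
  let M : Matrix (Fin L) (Fin L) ℝ := fun s t => ∏ i ∈ S t, (C s i - p t)
  let A : Matrix (Fin L) G ℝ := fun s T => ∏ i ∈ T.1, C s i
  let B : Matrix G (Fin L) ℝ := fun T t =>
    if T.1 ⊆ S t then ∏ _i ∈ S t \ T.1, (-p t) else 0
  have hM : M = A * B := by
    ext s t
    have h1 : (A * B) s t = ∑ T ∈ G, (∏ i ∈ T, C s i) *
        (if T ⊆ S t then ∏ _i ∈ S t \ T, (-p t) else 0) := by
      rw [Matrix.mul_apply]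
      exact Finset.sum_coe_sort G (fun T => (∏ i ∈ T, C s i) *
        (if T ⊆ S t then ∏ _i ∈ S t \ T, (-p t) else 0))
    rw [h1]
    have hsub : (S t).powerset ⊆ G := by
      intro T hT
      exact Finset.mem_biUnion.2 ⟨S t, hS t, hT⟩
    rw [← Finset.sum_subset hsub]
    · change ∏ i ∈ S t, (C s i - p t) = _
      simp only [sub_eq_add_neg]
      rw [Finset.prod_add]
      refine Finset.sum_congr rfl fun T hT => ?_
      rw [if_pos (Finset.mem_powerset.1 hT)]
    · intro T _ hT
      rw [if_neg (fun h => hT (Finset.mem_powerset.2 h)), mul_zero]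
  have htri : M.BlockTriangular id := by
    intro s t hst
    obtain ⟨i, hi, h⟩ := hb s t hst
    exact Finset.prod_eq_zero hi (sub_eq_zero.2 h)
  have hdet : M.det ≠ 0 := by
    rw [Matrix.det_of_upperTriangular htri]
    exact Finset.prod_ne_zero_iff.2 fun t _ =>
      Finset.prod_ne_zero_iff.2 fun i hi => sub_ne_zero.2 (ha t i hi)
  have hrank : M.rank = L := by
    rw [Matrix.rank_of_isUnit M ((Matrix.isUnit_iff_isUnit_det M).2 hdet.isUnit),
      Fintype.card_fin]
  calc L = (A * B).rank := by rw [← hM, hrank]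
    _ ≤ A.rank := Matrix.rank_mul_le_left A B
    _ ≤ Fintype.card G := Matrix.rank_le_card_width A
    _ = G.card := Fintype.card_coe G
end

section
/- For all integers m ≥ 1 and k ≥ m+1, √m · (k/(k−m))^{k−m+1/2} ≤ 2·4^m. -/
/-!
The auxiliary analytic inequality used in the `Ω(√|F|)` lower bound for
1-out-of-m Paging: `√m · (k/(k-m))^{k-m+1/2} ≤ 2·4^m`.
-/

theorem aux_pow (m : ℕ) : ((11:ℝ)/4)^(m+2) * ((m:ℝ)+3) ≤ 2 * 4^(m+2) := by
  induction m with
  | zero => norm_num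
  | succ n ih =>
    have h1 : (0:ℝ) < (11/4)^(n+2) := by positivity
    have hn : (0:ℝ) ≤ n := Nat.cast_nonneg n
    have e1 : ((11:ℝ)/4)^(n+1+2) = (11/4)^(n+2) * (11/4) := by ring
    have e2 : (4:ℝ)^(n+1+2) = 4^(n+2) * 4 := by ring
    rw [e1, e2]
    push_cast
    nlinarith [mul_nonneg h1.le hn]

theorem aux_pow' (m : ℕ) (hm : 1 ≤ m) : ((11:ℝ)/4)^m * ((m:ℝ)+1) ≤ 2 * 4^m := by
  obtain rfl | h := Nat.eq_or_lt_of_le hm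
  · norm_num
  · obtain ⟨n, rfl⟩ := Nat.exists_eq_add_of_le' h
    have := aux_pow n
    push_cast
    convert this using 2
    ring

/-- **Theorem.** For all integers `m ≥ 1` and `k ≥ m+1`,
`√m · (k/(k-m))^{k-m+1/2} ≤ 2·4^m`, where the power is a real power. -/
theorem sqrt_mul_rpow_le (m k : ℕ) (hm : 1 ≤ m) (hk : m + 1 ≤ k) :
    Real.sqrt m * ((k : ℝ) / ((k : ℝ) - (m : ℝ))) ^ ((k : ℝ) - (m : ℝ) + 1 / 2)
      ≤ 2 * 4 ^ m := by
  obtain ⟨j, rfl⟩ := Nat.exists_eq_add_of_le hk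
  have hj : (0:ℝ) ≤ j := Nat.cast_nonneg j
  have hm' : (1:ℝ) ≤ m := by exact_mod_cast hm
  have hd : (((m + 1 + j : ℕ) : ℝ) - (m : ℝ)) = (j:ℝ) + 1 := by push_cast; ring
  rw [hd]
  have hx : (((m + 1 + j : ℕ) : ℝ) / ((j:ℝ) + 1)) = (m:ℝ) / (j + 1) + 1 := by
    push_cast; field_simp; ring
  rw [hx]
  have hq : (0:ℝ) ≤ (m:ℝ) / (j + 1) := by positivity
  have hq' : (m:ℝ) / (j + 1) ≤ m := div_le_self (by linarith) (by linarith)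
  set q : ℝ := (m:ℝ) / (j + 1) with hqd
  rw [Real.rpow_add (by linarith), ← Real.sqrt_eq_rpow]
  have h1 : (q + 1) ^ ((j:ℝ) + 1) ≤ (11/4)^m := by
    calc (q + 1) ^ ((j:ℝ) + 1) ≤ (Real.exp q) ^ ((j:ℝ) + 1) :=
          Real.rpow_le_rpow (by linarith) (Real.add_one_le_exp q) (by linarith)
      _ = Real.exp m := by
          rw [← Real.exp_mul, hqd, div_mul_cancel₀]
          positivity
      _ = (Real.exp 1)^m := by rw [← Real.exp_nat_mul, mul_one]
      _ ≤ (11/4)^m := by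
          have := Real.exp_one_lt_d9
          exact pow_le_pow_left₀ (Real.exp_pos 1).le (by linarith) m
  have h2 : Real.sqrt m * Real.sqrt (q + 1) ≤ m + 1 := by
    rw [← Real.sqrt_mul (by linarith)]
    apply Real.sqrt_le_iff.mpr
    constructor
    · linarith
    · nlinarith
  calc Real.sqrt m * ((q + 1) ^ ((j:ℝ) + 1) * Real.sqrt (q + 1))
      = (q + 1) ^ ((j:ℝ) + 1) * (Real.sqrt m * Real.sqrt (q + 1)) := by ring
    _ ≤ (11/4)^m * (m + 1) := mul_le_mul h1 h2 (by positivity) (by positivity)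
    _ ≤ 2 * 4 ^ m := aux_pow' m hm
end

section
/- There exists an integer k₀ such that for every even integer k ≥ k₀ there is a family 𝒞 of subsets of [k], each of cardinality k/2, with |𝒞| ≥ ⌊e^{k/16}⌋ and with |S △ S'| ≥ k/16 for every two distinct members S, S' of 𝒞. -/
/-!
Existence of an exponentially large family of balanced (half-size) subsets of
`[k]` with pairwise symmetric difference at least `k/16` (Gilbert–Varshamov).
-/

lemma bce_exp_bound (k : ℕ) :
    Real.exp ((k : ℝ) / 16) * (4 : ℝ) ^ ((k : ℝ) / 16) ≤ (5 / 4 : ℝ) ^ k := by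
  have h1 : Real.exp ((k : ℝ) / 16) = (Real.exp (1 / 16)) ^ k := by
    rw [← Real.exp_nat_mul]; congr 1; ring
  have h2 : (4 : ℝ) ^ ((k : ℝ) / 16) = ((4 : ℝ) ^ (1 / 16 : ℝ)) ^ k := by
    rw [← Real.rpow_natCast, ← Real.rpow_mul (by norm_num)]; congr 1; ring
  rw [h1, h2, ← mul_pow]
  refine pow_le_pow_left₀ (by positivity) ?_ k
  refine le_of_pow_le_pow_left₀ (n := 16) (by norm_num) (by norm_num) ?_
  rw [mul_pow, ← Real.exp_nat_mul, ← Real.rpow_natCast, ← Real.rpow_mul (by norm_num)]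
  have h3 : Real.exp (((16 : ℕ) : ℝ) * (1 / 16)) = Real.exp 1 := by norm_num
  have h4 : (4 : ℝ) ^ ((1 / 16 : ℝ) * ((16 : ℕ) : ℝ)) = 4 := by norm_num
  rw [h3, h4]
  have := Real.exp_one_lt_d9
  norm_num at this ⊢
  linarith

lemma bce_ball (k : ℕ) :
    (((Finset.univ : Finset (Finset (Fin k))).filter
      (fun D => (D.card : ℝ) < (k : ℝ) / 16)).card : ℝ)
      ≤ (4 : ℝ) ^ ((k : ℝ) / 16) * (5 / 4 : ℝ) ^ k := by
  have hs : ∑ D : Finset (Fin k), (1 / 4 : ℝ) ^ D.card = (5 / 4 : ℝ) ^ k := by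
    have := Fintype.sum_pow_mul_eq_add_pow (Fin k) (1 / 4 : ℝ) 1
    simp only [one_pow, mul_one, Fintype.card_fin] at this
    rw [this]; norm_num
  rw [← hs, Finset.mul_sum, Finset.card_eq_sum_ones]
  push_cast
  refine (Finset.sum_le_sum ?_).trans
    (Finset.sum_le_sum_of_subset_of_nonneg (Finset.filter_subset _ _) ?_)
  · intro D hD
    have hD' := (Finset.mem_filter.1 hD).2
    have h : (4 : ℝ) ^ D.card ≤ (4 : ℝ) ^ ((k : ℝ) / 16) := by
      rw [← Real.rpow_natCast]
      exact Real.rpow_le_rpow_of_exponent_le (by norm_num) hD'.le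
    calc (1 : ℝ) = (4 : ℝ) ^ D.card * (1 / 4 : ℝ) ^ D.card := by
          rw [← mul_pow]; norm_num
      _ ≤ _ := by gcongr
  · intros; positivity

lemma bce_lin (n : ℕ) (hn : 26 ≤ n) :
    (2 * n : ℝ) * (25 / 16 : ℝ) ^ (2 * n) ≤ 4 ^ n := by
  have hb := one_add_mul_le_pow (a := (7 / 25 : ℝ)) (by norm_num) n
  have hn' : (26 : ℝ) ≤ n := by exact_mod_cast hn
  have h1 : (2 * n : ℝ) ≤ ((1 + 7 / 25 : ℝ) ^ n) ^ 2 := by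
    refine le_trans ?_ (pow_le_pow_left₀ (by positivity) hb 2)
    nlinarith
  calc (2 * n : ℝ) * (25 / 16 : ℝ) ^ (2 * n)
      ≤ ((1 + 7 / 25 : ℝ) ^ n) ^ 2 * (25 / 16 : ℝ) ^ (2 * n) := by gcongr
    _ = 4 ^ n := by
      rw [← pow_mul, mul_comm n 2, ← mul_pow, pow_mul]; norm_num

/-- **Theorem.** There is `k₀` such that for every even `k ≥ k₀` there is a family
`𝒞` of subsets of `[k]`, each of cardinality `k/2`, with `|𝒞| ≥ ⌊e^{k/16}⌋` and
with `|S △ S'| ≥ k/16` for every two distinct members `S, S'` of `𝒞`. -/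
theorem balanced_code_exists :
    ∃ k₀ : ℕ, ∀ k : ℕ, k₀ ≤ k → Even k →
      ∃ 𝒞 : Finset (Finset (Fin k)),
        (∀ S ∈ 𝒞, S.card = k / 2) ∧
        Nat.floor (Real.exp ((k : ℝ) / 16)) ≤ 𝒞.card ∧
        ∀ S ∈ 𝒞, ∀ S' ∈ 𝒞, S ≠ S' →
          (k : ℝ) / 16 ≤ ((symmDiff S S').card : ℝ) := by
  classical
  refine ⟨52, fun k hk hev => ?_⟩
  obtain ⟨n, hn⟩ := hev
  have hkn : k = 2 * n := by omega
  have hk2 : k / 2 = n := by omega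
  let P : Finset (Finset (Fin k)) → Prop := fun C =>
    (∀ S ∈ C, S.card = k / 2) ∧ ∀ S ∈ C, ∀ S' ∈ C, S ≠ S' →
          (k : ℝ) / 16 ≤ ((symmDiff S S').card : ℝ)
  obtain ⟨C, hC, hmax⟩ := Finset.exists_max_image (Finset.univ.filter P) Finset.card
    ⟨∅, by simp [P]⟩
  have hP : P C := (Finset.mem_filter.1 hC).2
  refine ⟨C, hP.1, ?_, hP.2⟩
  set B := (Finset.univ : Finset (Finset (Fin k))).filter
      (fun D => (D.card : ℝ) < (k : ℝ) / 16) with hB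
  have hkpos : (0 : ℝ) < (k : ℝ) / 16 := by
    have : (52 : ℝ) ≤ k := by exact_mod_cast hk
    linarith
  have hcov : Finset.powersetCard n (Finset.univ : Finset (Fin k)) ⊆
      (C ×ˢ B).image (fun p => symmDiff p.1 p.2) := by
    intro T hT
    have hTc := (Finset.mem_powersetCard.1 hT).2
    have : ∃ S ∈ C, ((symmDiff S T).card : ℝ) < (k : ℝ) / 16 := by
      by_contra! hcon
      have hTC : T ∉ C := fun h => by
        have := hcon T h
        simp at this
        linarith
      have hP' : P (insert T C) := by
        refine ⟨?_, ?_⟩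
        · intro S hS
          rcases Finset.mem_insert.1 hS with rfl | h
          · omega
          · exact hP.1 S h
        · intro S hS S' hS' hne
          rcases Finset.mem_insert.1 hS with rfl | h <;>
            rcases Finset.mem_insert.1 hS' with rfl | h'
          · exact absurd rfl hne
          · rw [symmDiff_comm]; exact hcon _ h'
          · exact hcon _ h
          · exact hP.2 S h S' h' hne
      have := hmax (insert T C) (by simp [hP'])
      rw [Finset.card_insert_of_notMem hTC] at this
      omega
    obtain ⟨S, hS, hd⟩ := this
    refine Finset.mem_image.2 ⟨(S, symmDiff S T), ?_, ?_⟩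
    · simp [hS, hB, hd]
    · simp
  have hcard : n.centralBinom ≤ C.card * B.card := by
    have := (Finset.card_le_card hcov).trans Finset.card_image_le
    rw [Finset.card_powersetCard, Finset.card_product, Finset.card_univ, Fintype.card_fin] at this
    have hc : n.centralBinom = k.choose n := by rw [Nat.centralBinom, ← hkn]
    rw [hc]
    exact this
  have h4 : (4 : ℝ) ^ n ≤ 2 * n * n.centralBinom := by
    exact_mod_cast Nat.four_pow_le_two_mul_self_mul_centralBinom n (by omega)
  have hcard' : (n.centralBinom : ℝ) ≤ C.card * B.card := by exact_mod_cast hcard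
  have hball := bce_ball k
  rw [← hB] at hball
  have hexp := bce_exp_bound k
  have hlin := bce_lin n (by omega)
  rw [← hkn] at hlin
  have hnpos : (0 : ℝ) < 2 * n := by
    have : 0 < n := by omega
    positivity
  set E := Real.exp ((k : ℝ) / 16)
  set R := (4 : ℝ) ^ ((k : ℝ) / 16)
  have hR : 0 < R := by positivity
  have h25 : (25 / 16 : ℝ) ^ k = (5 / 4 : ℝ) ^ k * (5 / 4 : ℝ) ^ k := by
    rw [← mul_pow]; norm_num
  have hmain : E ≤ C.card := by
    have hpos : 0 < 2 * (n : ℝ) * (R * (5 / 4 : ℝ) ^ k) := by positivity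
    refine le_of_mul_le_mul_right ?_ hpos
    calc E * (2 * (n : ℝ) * (R * (5 / 4 : ℝ) ^ k))
        = 2 * n * ((E * R) * (5 / 4 : ℝ) ^ k) := by ring
      _ ≤ 2 * n * ((5 / 4 : ℝ) ^ k * (5 / 4 : ℝ) ^ k) := by gcongr
      _ ≤ 4 ^ n := by rw [← h25]; exact hlin
      _ ≤ 2 * n * (C.card * B.card) := h4.trans (by gcongr)
      _ ≤ 2 * n * (C.card * (R * (5 / 4 : ℝ) ^ k)) := by gcongr
      _ = _ := by ring
  exact Nat.floor_le_of_le hmain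
end

section
/- Let k ≥ 4 be even and let 𝒞 be a family of balanced configurations such that any two distinct members Q(S_0, [k]∖S_0) and Q(S_0', [k]∖S_0') of 𝒞 satisfy |S_0 △ S_0'| ≥ 3. Let ψ(𝒞) be the set of all requests (p_i, S) with i ∈ {0,1} and |S| = k/2 that are satisfied by every configuration in 𝒞. Then an arbitrary configuration (a function from [k] to {p_0, p_1, empty}) satisfies every request in ψ(𝒞) if and only if it is a member of 𝒞. -/
/-!
Existence of forcing sequences: for a family `𝒞` of balanced configurations with
pairwise distance at least 3, the set `ψ(𝒞)` of all half-size requests satisfied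
by every member of `𝒞` is forcing for `𝒞`: an arbitrary configuration satisfies
every request of `ψ(𝒞)` iff it belongs to `𝒞`.
-/

/-- The two-page configuration holding page `p_0` (coded `false`) in every slot of
`S₀`, page `p_1` (coded `true`) in every slot of `S₁`, and empty elsewhere. -/
def Q {k : ℕ} (S₀ S₁ : Finset (Fin k)) : Fin k → Option Bool :=
  fun s => if s ∈ S₀ then some false else if s ∈ S₁ then some true else none

/-- A configuration satisfies the request `(p, S)` if some slot of `S` holds `p`. -/
def BSat {k : ℕ} (C : Fin k → Option Bool) (p : Bool) (S : Finset (Fin k)) : Prop :=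
  ∃ s ∈ S, C s = some p

/-- A set with more than `h ≥ 1` elements has two distinct `h`-subsets at distance at most 2. -/
theorem exists_close_pair {k h : ℕ} (hh : 1 ≤ h) (U : Finset (Fin k)) (hU : h < U.card) :
    ∃ S T : Finset (Fin k), S ⊆ U ∧ T ⊆ U ∧ S.card = h ∧ T.card = h ∧ S ≠ T ∧
      (symmDiff S T).card ≤ 2 := by
  obtain ⟨V, hVU, hV⟩ := Finset.exists_subset_card_eq (Nat.succ_le_of_lt hU)
  obtain ⟨a, ha, b, hb, hab⟩ := Finset.one_lt_card.mp (show 1 < V.card by omega)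
  refine ⟨V.erase a, V.erase b, (Finset.erase_subset _ _).trans hVU,
    (Finset.erase_subset _ _).trans hVU, ?_, ?_, ?_, ?_⟩
  · rw [Finset.card_erase_of_mem ha]; omega
  · rw [Finset.card_erase_of_mem hb]; omega
  · intro h
    have : a ∈ V.erase b := Finset.mem_erase.mpr ⟨hab, ha⟩
    rw [← h] at this
    simp at this
  · refine (Finset.card_le_card (t := {a, b}) ?_).trans Finset.card_le_two
    intro x hx
    simp only [Finset.mem_symmDiff, Finset.mem_erase, Finset.mem_insert,
      Finset.mem_singleton] at hx ⊢
    tauto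

/-- **Theorem.** Let `k ≥ 4` be even and let `𝒞` be a family of balanced
configurations `Q(S₀, [k] \ S₀)` (given by their `p_0`-sets `S₀` of cardinality
`k/2`) such that any two distinct members are at Hamming distance (symmetric
difference of `p_0`-sets) at least 3. Then an arbitrary configuration
`D : [k] → {p_0, p_1, empty}` satisfies every request `(p, S)` with `|S| = k/2`
that is satisfied by all members of `𝒞` — i.e. every request of `ψ(𝒞)` — if and
only if `D` is a member of `𝒞`. -/
theorem forcing_sequence_characterization {k : ℕ} (hk : 4 ≤ k) (hke : Even k)
    (𝒞 : Finset (Finset (Fin k)))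
    (hbal : ∀ S₀ ∈ 𝒞, S₀.card = k / 2)
    (hdist : ∀ S₀ ∈ 𝒞, ∀ S₀' ∈ 𝒞, S₀ ≠ S₀' → 3 ≤ (symmDiff S₀ S₀').card)
    (D : Fin k → Option Bool) :
    (∀ (p : Bool) (S : Finset (Fin k)), S.card = k / 2 →
        (∀ S₀ ∈ 𝒞, BSat (Q S₀ S₀ᶜ) p S) → BSat D p S)
      ↔ ∃ S₀ ∈ 𝒞, D = Q S₀ S₀ᶜ := by
  constructor
  · intro H
    obtain ⟨h, hh⟩ := hke
    have hk2 : k / 2 = h := by omega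
    rw [hk2] at H hbal
    set A0 : Finset (Fin k) := Finset.univ.filter (fun s => D s = some false) with hA0
    set A1 : Finset (Fin k) := Finset.univ.filter (fun s => D s = some true) with hA1
    have hdisj : Disjoint A0 A1 := by
      rw [Finset.disjoint_left]
      intro x hx hx'
      simp only [hA0, hA1, Finset.mem_filter, Finset.mem_univ, true_and] at hx hx'
      rw [hx] at hx'
      simp at hx'
    have key1 : ∀ S : Finset (Fin k), S.card = h → S ⊆ A1ᶜ → S ∈ 𝒞 := by
      intro S hS hSA
      by_contra hn
      obtain ⟨s, hs, hD⟩ := H true S hS (by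
        intro S₀ h0
        have : ¬ S ⊆ S₀ := fun hsub => hn (by
          rw [Finset.eq_of_subset_of_card_le hsub (by rw [hS, hbal _ h0])]; exact h0)
        obtain ⟨x, hx, hx0⟩ := Finset.not_subset.mp this
        exact ⟨x, hx, by simp [Q, hx0]⟩)
      have := hSA hs
      simp [hA1, hD] at this
    have key0 : ∀ S : Finset (Fin k), S.card = h → S ⊆ A0ᶜ → Sᶜ ∈ 𝒞 := by
      intro S hS hSA
      by_contra hn
      obtain ⟨s, hs, hD⟩ := H false S hS (by
        intro S₀ h0
        have : ¬ S ⊆ S₀ᶜ := fun hsub => hn (by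
          rw [Finset.eq_of_subset_of_card_le hsub (by
            rw [hS, Finset.card_compl, hbal _ h0, Fintype.card_fin]; omega), compl_compl]
          exact h0)
        obtain ⟨x, hx, hx0⟩ := Finset.not_subset.mp this
        have hx1 : x ∈ S₀ := by simpa using hx0
        exact ⟨x, hx, by simp [Q, hx1]⟩)
      have := hSA hs
      simp [hA0, hD] at this
    have c1 : A1ᶜ.card ≤ h := by
      by_contra hc
      obtain ⟨S, T, hS, hT, cS, cT, hne, hd⟩ := exists_close_pair (by omega) A1ᶜ (not_le.mp hc)
      have := hdist S (key1 S cS hS) T (key1 T cT hT) hne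
      omega
    have c0 : A0ᶜ.card ≤ h := by
      by_contra hc
      obtain ⟨S, T, hS, hT, cS, cT, hne, hd⟩ := exists_close_pair (by omega) A0ᶜ (not_le.mp hc)
      have := hdist Sᶜ (key0 S cS hS) Tᶜ (key0 T cT hT) (fun e => hne (compl_injective e))
      rw [compl_symmDiff_compl] at this
      omega
    have e1 := Finset.card_add_card_compl A1
    have e0 := Finset.card_add_card_compl A0
    rw [Fintype.card_fin] at e0 e1
    have hsub : A0 ⊆ A1ᶜ := by
      intro x hx
      rw [Finset.mem_compl]
      exact Finset.disjoint_left.mp hdisj hx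
    have hle := Finset.card_le_card hsub
    have heq : A0 = A1ᶜ := Finset.eq_of_subset_of_card_le hsub (by omega)
    refine ⟨A0, key1 A0 (by omega) hsub, ?_⟩
    funext s
    by_cases hs : s ∈ A0
    · have : D s = some false := by simpa [hA0] using hs
      simp [Q, hs, this]
    · have hs1 : s ∈ A1 := by
        rw [heq] at hs
        simpa using hs
      have : D s = some true := by simpa [hA1] using hs1
      simp [Q, hs, this]
  · rintro ⟨S₀, h0, rfl⟩ p S _ hS
    exact hS S₀ h0
end

section
/- Let π = (P_1,…,P_T) be a Page-Laminar Paging request sequence over a finite laminar family 𝒫 of height h, and define the standard Paging request sequence σ = (σ_1,…,σ_T) by σ_t = prev(P_t, t), where prev is the preferred-page function determined by π and a fixed choice function g. Then opt(σ) ≤ h · opt(π). -/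
/-!
The reduction from Page-Laminar Paging to standard Paging: replacing each set
request by its preferred page increases the optimum cost by at most a factor of
`h`, the height of the laminar family: `opt(σ) ≤ h · opt(π)`.
-/

/-- The optimal offline cost of a Page-Subset Paging request sequence
`π = (π 1, …, π T)` with cache size `k`: the minimum over configuration sequences
`C` (subsets of the page universe of cardinality at most `k`, with `C 0 = ∅` and
`C t ∩ π t ≠ ∅` for `1 ≤ t ≤ T`) of the total number of retrievals
`Σ_{t=1}^T |C t \ C (t-1)|`. Requests to a single page `p` are the special case
`π t = {p}` (standard Paging). -/
noncomputable def optSet {α : Type*} [DecidableEq α] (k : ℕ) (π : ℕ → Finset α)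
    (T : ℕ) : ℕ :=
  sInf { c | ∃ C : ℕ → Finset α, C 0 = ∅ ∧ (∀ t, (C t).card ≤ k) ∧
    (∀ t ∈ Finset.Icc 1 T, (C t ∩ π t).Nonempty) ∧
    c = ∑ t ∈ Finset.Icc 1 T, (C t \ C (t - 1)).card }

namespace PLP

open Classical in
/-- Members of the family hit by the cache `C`. -/
noncomputable def hits {α : Type*} (Fam : Finset (Finset α)) (C : Finset α) :
    Finset (Finset α) := Fam.filter (fun P => ∃ q ∈ C, q ∈ P)

open Classical in
/-- Maximal members of the family hit by `C`. -/
noncomputable def roots {α : Type*} (Fam : Finset (Finset α)) (C : Finset α) :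
    Finset (Finset α) := (hits Fam C).filter (fun P => ∀ Q ∈ Fam, P ⊆ Q → Q = P)

open Classical in
/-- Segment bottoms. -/
noncomputable def bots {α : Type*} (Fam : Finset (Finset α)) (C : Finset α)
    (b : Finset α → Finset α) : Finset (Finset α) := (hits Fam C).image b

open Classical in
/-- For each owner, the topmost owned bottom. -/
noncomputable def tops {α : Type*} (Fam : Finset (Finset α)) (C : Finset α)
    (b : Finset α → Finset α) (o : Finset α → α) : Finset (Finset α) :=
  (bots Fam C b).filter (fun X => ∀ Y ∈ bots Fam C b, o Y = o X → Y ⊆ X)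

open Classical in
/-- The simulated cache. -/
noncomputable def sim {α : Type*} (Fam : Finset (Finset α)) (v : Finset α → α) (C : Finset α)
    (b : Finset α → Finset α) (o : Finset α → α) : Finset α :=
  (tops Fam C b o).image v

/-- The invariant of the simulation. -/
structure Inv {α : Type*} (Fam : Finset (Finset α)) (v : Finset α → α) (C : Finset α)
    (b : Finset α → Finset α) (o : Finset α → α) : Prop where
  mem : ∀ P ∈ hits Fam C, b P ∈ Fam
  sub : ∀ P ∈ hits Fam C, b P ⊆ P
  val : ∀ P ∈ hits Fam C, v (b P) = v P
  cont : ∀ P ∈ hits Fam C, ∀ P' ∈ Fam, b P ⊆ P' → P' ⊆ P → b P' = b P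
  ownC : ∀ P ∈ hits Fam C, o (b P) ∈ C
  ownP : ∀ P ∈ hits Fam C, o (b P) ∈ b P

section
variable {α : Type*} {Fam : Finset (Finset α)}

/-- Two members sharing a point are comparable. -/
def Lam (Fam : Finset (Finset α)) : Prop :=
  ∀ P ∈ Fam, ∀ Q ∈ Fam, ∀ q, q ∈ P → q ∈ Q → P ⊆ Q ∨ Q ⊆ P

theorem mem_hits {C P : Finset α} : P ∈ hits Fam C ↔ P ∈ Fam ∧ ∃ q ∈ C, q ∈ P := by
  simp [hits]

theorem mem_roots {C P : Finset α} :
    P ∈ roots Fam C ↔ P ∈ hits Fam C ∧ ∀ Q ∈ Fam, P ⊆ Q → Q = P := by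
  simp [roots]

theorem mem_bots {C X : Finset α} {b : Finset α → Finset α} :
    X ∈ bots Fam C b ↔ ∃ P ∈ hits Fam C, b P = X := by
  simp [bots]

theorem mem_tops {C X : Finset α} {b : Finset α → Finset α} {o : Finset α → α} :
    X ∈ tops Fam C b o ↔ X ∈ bots Fam C b ∧ ∀ Y ∈ bots Fam C b, o Y = o X → Y ⊆ X := by
  simp [tops]

theorem mem_sim {C : Finset α} {v : Finset α → α} {b : Finset α → Finset α}
    {o : Finset α → α} {x : α} :
    x ∈ sim Fam v C b o ↔ ∃ X ∈ tops Fam C b o, v X = x := by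
  simp [sim]

theorem Inv.hit {v : Finset α → α} {C : Finset α} {b : Finset α → Finset α} {o : Finset α → α}
    (I : Inv Fam v C b o) {P : Finset α} (hP : P ∈ hits Fam C) : b P ∈ hits Fam C :=
  mem_hits.2 ⟨I.mem P hP, _, I.ownC P hP, I.ownP P hP⟩

theorem Inv.idem {v : Finset α → α} {C : Finset α} {b : Finset α → Finset α} {o : Finset α → α}
    (I : Inv Fam v C b o) {P : Finset α} (hP : P ∈ hits Fam C) : b (b P) = b P :=
  I.cont P hP _ (I.mem P hP) (Finset.Subset.refl _) (I.sub P hP)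

/-- Facts about a bottom. -/
theorem Inv.bot {v : Finset α → α} {C : Finset α} {b : Finset α → Finset α} {o : Finset α → α}
    (I : Inv Fam v C b o) {X : Finset α} (hX : X ∈ bots Fam C b) :
    X ∈ hits Fam C ∧ X ∈ Fam ∧ b X = X ∧ o X ∈ C ∧ o X ∈ X := by
  obtain ⟨P, hP, rfl⟩ := mem_bots.1 hX
  exact ⟨I.hit hP, I.mem P hP, I.idem hP, I.ownC P hP, I.ownP P hP⟩

theorem tops_inj {C : Finset α} {b : Finset α → Finset α} {o : Finset α → α} {X Y : Finset α}
    (hX : X ∈ tops Fam C b o) (hY : Y ∈ tops Fam C b o) (h : o X = o Y) : X = Y :=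
  Finset.Subset.antisymm ((mem_tops.1 hY).2 X (mem_tops.1 hX).1 h)
    ((mem_tops.1 hX).2 Y (mem_tops.1 hY).1 h.symm)

theorem sim_card {v : Finset α → α} {C : Finset α} {b : Finset α → Finset α} {o : Finset α → α}
    (I : Inv Fam v C b o) : (sim Fam v C b o).card ≤ C.card := by
  classical
  refine le_trans (b := (tops Fam C b o).card) (by unfold sim; convert Finset.card_image_le) ?_
  refine Finset.card_le_card_of_injOn o ?_ ?_
  · intro X hX
    exact (I.bot (mem_tops.1 hX).1).2.2.2.1
  · intro X hX Y hY h
    exact tops_inj hX hY h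

/-- Request step. -/
theorem request [DecidableEq α] (hL : Lam Fam) {v v' : Finset α → α} {C : Finset α}
    {b : Finset α → Finset α}
    {o : Finset α → α} (I : Inv Fam v C b o) {P : Finset α} (hP : P ∈ hits Fam C)
    (h1 : ∀ A ∈ Fam, P ⊆ A → v' A = v P) (h2 : ∀ A ∈ Fam, ¬ P ⊆ A → v' A = v A) :
    ∃ b', Inv Fam v' C b' o ∧ v P ∈ sim Fam v' C b' o ∧
      (sim Fam v' C b' o \ sim Fam v C b o).card + (bots Fam C b').card
        ≤ (bots Fam C b).card := by
  classical
  have hPF := (mem_hits.1 hP).1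
  set b' : Finset α → Finset α := fun A => if P ⊆ A then b P else b A with hb'
  have b1 : ∀ A, P ⊆ A → b' A = b P := fun A h => by simp [hb', h]
  have b2 : ∀ A, ¬ P ⊆ A → b' A = b A := fun A h => by simp [hb', h]
  have hv : ∀ X ∈ Fam, ¬ P ⊂ X → v' X = v X := by
    intro X hX hn
    by_cases h : P ⊆ X
    · have : X = P := by
        by_contra hne
        exact hn (Finset.ssubset_iff_subset_ne.2 ⟨h, fun e => hne e.symm⟩)
      rw [h1 X hX h, this]
    · exact h2 X hX h
  have hnb : ¬ P ⊂ b P := fun h => h.2 (I.sub P hP)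
  have I' : Inv Fam v' C b' o := by
    refine ⟨?_, ?_, ?_, ?_, ?_, ?_⟩
    · intro A hA
      by_cases h : P ⊆ A
      · rw [b1 A h]; exact I.mem P hP
      · rw [b2 A h]; exact I.mem A hA
    · intro A hA
      by_cases h : P ⊆ A
      · rw [b1 A h]; exact (I.sub P hP).trans h
      · rw [b2 A h]; exact I.sub A hA
    · intro A hA
      have hAF := (mem_hits.1 hA).1
      by_cases h : P ⊆ A
      · rw [b1 A h, h1 A hAF h, hv _ (I.mem P hP) hnb, I.val P hP]
      · rw [b2 A h, h2 A hAF h, h2 _ (I.mem A hA) (fun h' => h (h'.trans (I.sub A hA))),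
          I.val A hA]
    · intro A hA A' hA' s1 s2
      by_cases h : P ⊆ A
      · rw [b1 A h] at s1 ⊢
        by_cases h' : P ⊆ A'
        · rw [b1 A' h']
        · rw [b2 A' h']
          have := hL P hPF A' hA' _ (I.sub P hP (I.ownP P hP)) (s1 (I.ownP P hP))
          exact I.cont P hP A' hA' s1 (this.resolve_left h')
      · rw [b2 A h] at s1 ⊢
        rw [b2 A' (fun h' => h (h'.trans s2))]
        exact I.cont A hA A' hA' s1 s2
    · intro A hA
      by_cases h : P ⊆ A
      · rw [b1 A h]; exact I.ownC P hP
      · rw [b2 A h]; exact I.ownC A hA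
    · intro A hA
      by_cases h : P ⊆ A
      · rw [b1 A h]; exact I.ownP P hP
      · rw [b2 A h]; exact I.ownP A hA
  have hsub : bots Fam C b' ⊆ bots Fam C b := by
    intro X hX
    obtain ⟨A, hA, rfl⟩ := mem_bots.1 hX
    by_cases h : P ⊆ A
    · rw [b1 A h]; exact mem_bots.2 ⟨P, hP, rfl⟩
    · rw [b2 A h]; exact mem_bots.2 ⟨A, hA, rfl⟩
  have hns : ∀ X ∈ bots Fam C b', ¬ P ⊂ X := by
    intro X hX
    obtain ⟨A, hA, rfl⟩ := mem_bots.1 hX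
    by_cases h : P ⊆ A
    · rw [b1 A h]; exact hnb
    · rw [b2 A h]; exact fun h' => h (h'.1.trans (I.sub A hA))
  refine ⟨b', I', ?_, ?_⟩
  · refine mem_sim.2 ⟨b P, mem_tops.2 ⟨mem_bots.2 ⟨P, hP, b1 P (Finset.Subset.refl _)⟩, ?_⟩, ?_⟩
    · intro Y hY hYo
      obtain ⟨-, hYF, hbY, -, hYY⟩ := I.bot (hsub hY)
      rw [hYo] at hYY
      have c1 : Y ⊆ P := by
        rcases hL P hPF Y hYF _ (I.sub P hP (I.ownP P hP)) hYY with h | h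
        · by_contra hn
          exact hns Y hY ⟨h, hn⟩
        · exact h
      rcases hL Y hYF (b P) (I.mem P hP) _ hYY (I.ownP P hP) with h | h
      · exact h
      · have := I.cont P hP Y hYF h c1
        rw [hbY] at this
        rw [this]
    · rw [hv _ (I.mem P hP) hnb, I.val P hP]
  · have e1 : (sim Fam v' C b' o \ sim Fam v C b o).card
        ≤ (tops Fam C b' o \ tops Fam C b o).card := by
      refine le_trans (Finset.card_le_card (t := (tops Fam C b' o \ tops Fam C b o).image v') ?_)
        Finset.card_image_le
      intro x hx
      obtain ⟨hx1, hx2⟩ := Finset.mem_sdiff.1 hx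
      obtain ⟨X, hX, rfl⟩ := mem_sim.1 hx1
      refine Finset.mem_image.2 ⟨X, Finset.mem_sdiff.2 ⟨hX, fun hX' => hx2 ?_⟩, rfl⟩
      have hXb := (mem_tops.1 hX).1
      exact mem_sim.2 ⟨X, hX', (hv X (I.bot (hsub hXb)).2.1 (hns X hXb)).symm⟩
    have e2 : (tops Fam C b' o \ tops Fam C b o).card
        ≤ (bots Fam C b \ bots Fam C b').card := by
      have : ∀ X ∈ tops Fam C b' o \ tops Fam C b o,
          ∃ Y ∈ bots Fam C b \ bots Fam C b', o Y = o X := by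
        intro X hX
        obtain ⟨hX1, hX2⟩ := Finset.mem_sdiff.1 hX
        by_contra hcon
        push Not at hcon
        refine hX2 (mem_tops.2 ⟨hsub (mem_tops.1 hX1).1, fun Y hY hYo => ?_⟩)
        by_cases hY' : Y ∈ bots Fam C b'
        · exact (mem_tops.1 hX1).2 Y hY' hYo
        · exact absurd hYo (hcon Y (Finset.mem_sdiff.2 ⟨hY, hY'⟩))
      choose! f hf1 hf2 using this
      refine Finset.card_le_card_of_injOn f (fun X hX => hf1 X hX) ?_
      intro X hX Y hY hXY
      refine tops_inj (Finset.mem_sdiff.1 hX).1 (Finset.mem_sdiff.1 hY).1 ?_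
      rw [← hf2 X hX, ← hf2 Y hY, hXY]
    have e3 := Finset.card_sdiff_add_card_eq_card hsub
    omega

/-- Retrieval step. -/
theorem retrieve [DecidableEq α] (h : ℕ)
    (hh : ∀ q : α, ∀ S : Finset (Finset α),
      (∀ P ∈ S, P ∈ Fam ∧ q ∈ P ∧ ∃ Q ∈ Fam, P ⊆ Q ∧ Q ≠ P) → S.card ≤ h - 1)
    {v : Finset α → α} {C C' : Finset α} {b : Finset α → Finset α}
    {o : Finset α → α} (I : Inv Fam v C b o) (hCC : C ⊆ C') :
    ∃ b' o', Inv Fam v C' b' o' ∧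
      (sim Fam v C' b' o' \ sim Fam v C b o).card ≤ (C' \ C).card ∧
      (bots Fam C' b').card + (roots Fam C).card
        ≤ (bots Fam C b).card + (roots Fam C').card + (h - 1) * (C' \ C).card := by
  classical
  have hsubh : hits Fam C ⊆ hits Fam C' := by
    intro P hP
    obtain ⟨h1, q, h2, h3⟩ := mem_hits.1 hP
    exact mem_hits.2 ⟨h1, q, hCC h2, h3⟩
  have hup : ∀ P ∈ hits Fam C, ∀ Q ∈ Fam, P ⊆ Q → Q ∈ hits Fam C := by
    intro P hP Q hQ hs
    obtain ⟨h1, q, h2, h3⟩ := mem_hits.1 hP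
    exact mem_hits.2 ⟨hQ, q, h2, hs h3⟩
  have hch : ∀ P ∈ hits Fam C', ∃ q ∈ C', q ∈ P := fun P hP => (mem_hits.1 hP).2
  have hne : ∀ P : Finset α, ∃ q : α, P ∈ hits Fam C' → q ∈ C' ∧ q ∈ P := by
    intro P
    by_cases hP : P ∈ hits Fam C'
    · obtain ⟨q, h1, h2⟩ := hch P hP
      exact ⟨q, fun _ => ⟨h1, h2⟩⟩
    · exact ⟨v P, fun h => absurd h hP⟩
  choose w hw using hne
  set b' : Finset α → Finset α := fun P => if P ∈ hits Fam C then b P else P with hb'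
  set o' : Finset α → α := fun P => if P ∈ hits Fam C then o P else w P with ho'
  have b1 : ∀ P, P ∈ hits Fam C → b' P = b P := fun P h => by simp [hb', h]
  have b2 : ∀ P, P ∉ hits Fam C → b' P = P := fun P h => by simp [hb', h]
  have o1 : ∀ P, P ∈ hits Fam C → o' P = o P := fun P h => by simp [ho', h]
  have o2 : ∀ P, P ∉ hits Fam C → o' P = w P := fun P h => by simp [ho', h]
  have I' : Inv Fam v C' b' o' := by
    refine ⟨?_, ?_, ?_, ?_, ?_, ?_⟩
    · intro P hP
      by_cases hc : P ∈ hits Fam C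
      · rw [b1 P hc]; exact I.mem P hc
      · rw [b2 P hc]; exact (mem_hits.1 hP).1
    · intro P hP
      by_cases hc : P ∈ hits Fam C
      · rw [b1 P hc]; exact I.sub P hc
      · rw [b2 P hc]
    · intro P hP
      by_cases hc : P ∈ hits Fam C
      · rw [b1 P hc]; exact I.val P hc
      · rw [b2 P hc]
    · intro P hP P' hP' s1 s2
      by_cases hc : P ∈ hits Fam C
      · rw [b1 P hc] at s1 ⊢
        rw [b1 P' (hup _ (I.hit hc) P' hP' s1)]
        exact I.cont P hc P' hP' s1 s2
      · rw [b2 P hc] at s1 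
        rw [Finset.Subset.antisymm s1 s2]
    · intro P hP
      by_cases hc : P ∈ hits Fam C
      · rw [b1 P hc, o1 _ (I.hit hc)]; exact hCC (I.ownC P hc)
      · rw [b2 P hc, o2 P hc]; exact (hw P hP).1
    · intro P hP
      by_cases hc : P ∈ hits Fam C
      · rw [b1 P hc, o1 _ (I.hit hc)]; exact I.ownP P hc
      · rw [b2 P hc, o2 P hc]; exact (hw P hP).2
  have hbots : bots Fam C b ⊆ bots Fam C' b' := by
    intro X hX
    obtain ⟨P, hP, rfl⟩ := mem_bots.1 hX
    exact mem_bots.2 ⟨P, hsubh hP, b1 P hP⟩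
  have hbots2 : bots Fam C' b' ⊆ bots Fam C b ∪ (hits Fam C' \ hits Fam C) := by
    intro X hX
    obtain ⟨P, hP, rfl⟩ := mem_bots.1 hX
    by_cases hc : P ∈ hits Fam C
    · rw [b1 P hc]; exact Finset.mem_union_left _ (mem_bots.2 ⟨P, hc, rfl⟩)
    · rw [b2 P hc]; exact Finset.mem_union_right _ (Finset.mem_sdiff.2 ⟨hP, hc⟩)
  refine ⟨b', o', I', ?_, ?_⟩
  · refine le_trans (Finset.card_le_card
      (t := ((tops Fam C' b' o').filter (fun X => o' X ∈ C' \ C)).image v) ?_) ?_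
    · intro x hx
      obtain ⟨hx1, hx2⟩ := Finset.mem_sdiff.1 hx
      obtain ⟨X, hX, rfl⟩ := mem_sim.1 hx1
      obtain ⟨hX1, hX2⟩ := mem_tops.1 hX
      obtain ⟨hXh, hXF, -, hXC, hXX⟩ := I'.bot hX1
      refine Finset.mem_image.2 ⟨X, Finset.mem_filter.2 ⟨hX, Finset.mem_sdiff.2
        ⟨hXC, fun hc => hx2 ?_⟩⟩, rfl⟩
      have hXC : X ∈ hits Fam C := mem_hits.2 ⟨hXF, _, hc, hXX⟩
      have hXb : X ∈ bots Fam C b := by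
        rcases Finset.mem_union.1 (hbots2 hX1) with h | h
        · exact h
        · exact absurd hXC (Finset.mem_sdiff.1 h).2
      refine mem_sim.2 ⟨X, mem_tops.2 ⟨hXb, fun Y hY hYo => hX2 Y (hbots hY) ?_⟩, rfl⟩
      rw [o1 X hXC, o1 Y (I.bot hY).1, hYo]
    · refine le_trans Finset.card_image_le ?_
      refine Finset.card_le_card_of_injOn o' (fun X hX => (Finset.mem_filter.1 hX).2) ?_
      intro X hX Y hY hXY
      exact tops_inj (Finset.mem_filter.1 hX).1 (Finset.mem_filter.1 hY).1 hXY
  · set N := hits Fam C' \ hits Fam C with hN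
    set M := N.filter (fun P => ∀ Q ∈ Fam, P ⊆ Q → Q = P) with hM
    set K := N.filter (fun P => ¬ ∀ Q ∈ Fam, P ⊆ Q → Q = P) with hK
    have e1 : (bots Fam C' b').card ≤ (bots Fam C b).card + N.card :=
      (Finset.card_le_card hbots2).trans (Finset.card_union_le _ _)
    have e2 : M.card + K.card = N.card := Finset.card_filter_add_card_filter_not _
    have e3 : M.card + (roots Fam C).card ≤ (roots Fam C').card := by
      rw [← Finset.card_union_of_disjoint]
      · refine Finset.card_le_card ?_
        intro P hP
        rcases Finset.mem_union.1 hP with h | h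
        · obtain ⟨h1, h2⟩ := Finset.mem_filter.1 h
          exact mem_roots.2 ⟨(Finset.mem_sdiff.1 h1).1, h2⟩
        · obtain ⟨h1, h2⟩ := mem_roots.1 h
          exact mem_roots.2 ⟨hsubh h1, h2⟩
      · rw [Finset.disjoint_left]
        intro P hP hP'
        exact (Finset.mem_sdiff.1 (Finset.mem_filter.1 hP).1).2 (mem_roots.1 hP').1
    have e4 : K.card ≤ (C' \ C).card * (h - 1) := by
      refine le_trans (Finset.card_le_card
        (t := (C' \ C).biUnion (fun q => K.filter (fun P => q ∈ P))) ?_)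
        (Finset.card_biUnion_le_card_mul _ _ _ ?_)
      · intro P hP
        obtain ⟨h1, h2⟩ := Finset.mem_sdiff.1 (Finset.mem_filter.1 hP).1
        obtain ⟨hF, q, hq, hqP⟩ := mem_hits.1 h1
        refine Finset.mem_biUnion.2 ⟨q, Finset.mem_sdiff.2 ⟨hq, fun hc => h2 ?_⟩,
          Finset.mem_filter.2 ⟨hP, hqP⟩⟩
        exact mem_hits.2 ⟨hF, q, hc, hqP⟩
      · intro q hq
        refine hh q _ ?_
        intro P hP
        obtain ⟨h1, h2⟩ := Finset.mem_filter.1 hP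
        obtain ⟨h3, h4⟩ := Finset.mem_filter.1 h1
        push Not at h4
        exact ⟨(mem_hits.1 (Finset.mem_sdiff.1 h3).1).1, h2, h4⟩
    rw [mul_comm] at e4
    omega

/-- A nonempty finset of sets sharing a point has a least element. -/
theorem exists_least (hL : Lam Fam) (S : Finset (Finset α)) (hS : S.Nonempty) (q : α)
    (h : ∀ P ∈ S, P ∈ Fam ∧ q ∈ P) : ∃ P ∈ S, ∀ Q ∈ S, P ⊆ Q := by
  obtain ⟨P, hP, hmin⟩ := Finset.exists_min_image S Finset.card hS
  refine ⟨P, hP, fun Q hQ => ?_⟩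
  rcases hL P (h P hP).1 Q (h Q hQ).1 q (h P hP).2 (h Q hQ).2 with h' | h'
  · exact h'
  · rw [Finset.eq_of_subset_of_card_le h' (hmin Q hQ)]

/-- Eviction step. -/
theorem evict (hL : Lam Fam) {v : Finset α → α} {C C' : Finset α}
    {b : Finset α → Finset α}
    {o : Finset α → α} (I : Inv Fam v C b o) (hCC : C' ⊆ C) :
    ∃ b' o', Inv Fam v C' b' o' ∧ sim Fam v C' b' o' ⊆ sim Fam v C b o ∧
      (bots Fam C' b').card + (roots Fam C).card
        ≤ (bots Fam C b).card + (roots Fam C').card := by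
  classical
  have hsubh : hits Fam C' ⊆ hits Fam C := by
    intro P hP
    obtain ⟨h1, q, h2, h3⟩ := mem_hits.1 hP
    exact mem_hits.2 ⟨h1, q, hCC h2, h3⟩
  have hup : ∀ P ∈ hits Fam C', ∀ Q ∈ Fam, P ⊆ Q → Q ∈ hits Fam C' := by
    intro P hP Q hQ hs
    obtain ⟨h1, q, h2, h3⟩ := mem_hits.1 hP
    exact mem_hits.2 ⟨hQ, q, h2, hs h3⟩
  have hm : ∀ X : Finset α, ∃ p : Finset α, ∀ P ∈ hits Fam C', b P = X →
      p ∈ hits Fam C' ∧ b p = X ∧ p ⊆ P := by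
    intro X
    by_cases hS : ((hits Fam C').filter (fun P => b P = X)).Nonempty
    · obtain ⟨p, hp, hmin⟩ := exists_least hL _ hS (o X) (by
        intro P hP
        obtain ⟨h1, h2⟩ := Finset.mem_filter.1 hP
        refine ⟨(mem_hits.1 h1).1, ?_⟩
        rw [← h2]
        exact I.sub P (hsubh h1) (I.ownP P (hsubh h1)))
      obtain ⟨hp1, hp2⟩ := Finset.mem_filter.1 hp
      exact ⟨p, fun P hP hb => ⟨hp1, hp2, hmin P (Finset.mem_filter.2 ⟨hP, hb⟩)⟩⟩
    · exact ⟨∅, fun P hP hb => absurd ⟨P, Finset.mem_filter.2 ⟨hP, hb⟩⟩ hS⟩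
  choose m hm using hm
  set b' : Finset α → Finset α := fun P => m (b P) with hb'
  have B : ∀ P ∈ hits Fam C', b' P ∈ hits Fam C' ∧ b (b' P) = b P ∧ b' P ⊆ P :=
    fun P hP => hm (b P) P hP rfl
  have hr : ∀ q : α, ∃ r : α, ∀ P ∈ hits Fam C', o (b P) = q → r ∈ C' ∧ r ∈ b' P := by
    intro q
    by_cases hS : (((hits Fam C').filter (fun P => o (b P) = q)).image b').Nonempty
    · obtain ⟨p, hp, hmin⟩ := exists_least hL _ hS q (by
        intro P hP
        obtain ⟨P, hP2, rfl⟩ := Finset.mem_image.1 hP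
        obtain ⟨h1, h2⟩ := Finset.mem_filter.1 hP2
        obtain ⟨h3, h4, h5⟩ := B P h1
        refine ⟨(mem_hits.1 h3).1, ?_⟩
        rw [← h2]
        have := I.sub _ (hsubh h3)
        rw [h4] at this
        exact this (I.ownP P (hsubh h1)))
      obtain ⟨P, hP, rfl⟩ := Finset.mem_image.1 hp
      obtain ⟨h1, h2⟩ := Finset.mem_filter.1 hP
      obtain ⟨-, r, hr1, hr2⟩ := mem_hits.1 (B P h1).1
      exact ⟨r, fun Q hQ hb => ⟨hr1, hmin _ (Finset.mem_image.2
        ⟨Q, Finset.mem_filter.2 ⟨hQ, hb⟩, rfl⟩) hr2⟩⟩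
    · exact ⟨q, fun P hP hb => absurd ⟨b' P, Finset.mem_image.2
        ⟨P, Finset.mem_filter.2 ⟨hP, hb⟩, rfl⟩⟩ hS⟩
  choose r hr using hr
  set o' : Finset α → α := fun p => r (o (b p)) with ho'
  have O : ∀ P ∈ hits Fam C', o' (b' P) ∈ C' ∧ o' (b' P) ∈ b' P := by
    intro P hP
    have := hr (o (b P)) P hP rfl
    simp only [ho']
    rw [(B P hP).2.1]
    exact this
  have I' : Inv Fam v C' b' o' := by
    refine ⟨?_, ?_, ?_, ?_, ?_, ?_⟩
    · intro P hP
      exact (mem_hits.1 (B P hP).1).1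
    · intro P hP
      exact (B P hP).2.2
    · intro P hP
      obtain ⟨h1, h2, h3⟩ := B P hP
      rw [← I.val P (hsubh hP), ← h2, I.val _ (hsubh h1)]
    · intro P hP P' hP' s1 s2
      obtain ⟨h1, h2, h3⟩ := B P hP
      have h4 := I.sub _ (hsubh h1)
      rw [h2] at h4
      have := I.cont P (hsubh hP) P' hP' (h4.trans s1) s2
      simp only [hb']
      rw [this]
    · intro P hP
      exact (O P hP).1
    · intro P hP
      exact (O P hP).2
  refine ⟨b', o', I', ?_, ?_⟩
  · intro x hx
    obtain ⟨p, hp, rfl⟩ := mem_sim.1 hx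
    obtain ⟨hp1, hp2⟩ := mem_tops.1 hp
    obtain ⟨hph, hpF, hbp, -, -⟩ := I'.bot hp1
    have hphC := hsubh hph
    refine mem_sim.2 ⟨b p, mem_tops.2 ⟨mem_bots.2 ⟨p, hphC, rfl⟩, ?_⟩, I.val p hphC⟩
    intro Y hY hYo
    obtain ⟨hYh, hYF, hbY, hYC, hYY⟩ := I.bot hY
    rw [hYo] at hYY
    have hq1 := I.ownP p hphC
    rcases hL Y hYF (b p) (I.mem p hphC) _ hYY hq1 with h | h
    · exact h
    rcases hL Y hYF p hpF _ hYY (I.sub p hphC hq1) with h' | h'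
    · have := I.cont p hphC Y hYF h h'
      rw [hbY] at this
      rw [this]
    · have hYh' := hup p hph Y hYF h'
      obtain ⟨h1, h2, h3⟩ := B Y hYh'
      have hYe : b' Y = Y := by
        refine Finset.Subset.antisymm h3 ?_
        have := I.sub _ (hsubh h1)
        rwa [h2, hbY] at this
      have h4 := hp2 Y (mem_bots.2 ⟨Y, hYh', hYe⟩) (by
        simp only [ho']
        rw [hbY, hYo])
      have h5 := I.cont p hphC Y hYF h h4
      rw [hbY] at h5
      rw [h5]
  · have e1 : ((bots Fam C' b').image b).card = (bots Fam C' b').card := by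
      refine Finset.card_image_of_injOn ?_
      intro X hX Y hY hXY
      have h1 := (I'.bot hX).2.2.1
      have h2 := (I'.bot hY).2.2.1
      simp only [hb'] at h1 h2
      have hXY : b X = b Y := hXY
      rw [← h1, ← h2, hXY]
    set R := roots Fam C \ roots Fam C' with hR
    have key : ∀ P ∈ hits Fam C, ∀ Q ∈ roots Fam C, b P = b Q → P ⊆ Q := by
      intro P hP Q hQ hb
      obtain ⟨hQ1, hQ2⟩ := mem_roots.1 hQ
      have hP1 := I.sub P hP (I.ownP P hP)
      have hq := I.sub Q hQ1 (I.ownP Q hQ1)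
      rw [← hb] at hq
      rcases hL P (mem_hits.1 hP).1 Q (mem_hits.1 hQ1).1 _ hP1 hq with h | h
      · exact h
      · rw [hQ2 P (mem_hits.1 hP).1 h]
    have e2 : (R.image b).card = R.card := by
      refine Finset.card_image_of_injOn ?_
      intro X hX Y hY hXY
      have h1 := (Finset.mem_sdiff.1 hX).1
      have h2 := (Finset.mem_sdiff.1 hY).1
      exact Finset.Subset.antisymm (key X (mem_roots.1 h1).1 Y h2 hXY)
        (key Y (mem_roots.1 h2).1 X h1 hXY.symm)
    have e3 : Disjoint ((bots Fam C' b').image b) (R.image b) := by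
      rw [Finset.disjoint_left]
      intro X hX hX'
      obtain ⟨p, hp, rfl⟩ := Finset.mem_image.1 hX
      obtain ⟨Q, hQ, hQp⟩ := Finset.mem_image.1 hX'
      obtain ⟨hQ1, hQ2⟩ := Finset.mem_sdiff.1 hQ
      have hph := (I'.bot hp).1
      obtain ⟨hQ3, hQ4⟩ := mem_roots.1 hQ1
      have := key p (hsubh hph) Q hQ1 hQp.symm
      exact hQ2 (mem_roots.2 ⟨hup p hph Q (mem_hits.1 hQ3).1 this, hQ4⟩)
    have e4 : (bots Fam C' b').image b ∪ R.image b ⊆ bots Fam C b := by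
      intro X hX
      rcases Finset.mem_union.1 hX with h | h
      · obtain ⟨p, hp, rfl⟩ := Finset.mem_image.1 h
        exact mem_bots.2 ⟨p, hsubh (I'.bot hp).1, rfl⟩
      · obtain ⟨Q, hQ, rfl⟩ := Finset.mem_image.1 h
        exact mem_bots.2 ⟨Q, (mem_roots.1 (Finset.mem_sdiff.1 hQ).1).1, rfl⟩
    have e5 := Finset.card_le_card e4
    rw [Finset.card_union_of_disjoint e3, e1, e2] at e5
    have e6 : (roots Fam C).card ≤ R.card + (roots Fam C').card := by
      have := Finset.le_card_sdiff (roots Fam C') (roots Fam C)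
      rw [← hR] at this
      omega
    omega

/-- Chains of members through a point, none of them maximal, have at most `h - 1` members. -/
theorem chain_bound (hL : Lam Fam) (h : ℕ)
    (hheight : ∀ (r : ℕ) (Q : Fin r → Finset α),
      (∀ i, Q i ∈ Fam) → StrictMono Q → r ≤ h) (q : α) (S : Finset (Finset α))
    (hS : ∀ P ∈ S, P ∈ Fam ∧ q ∈ P ∧ ∃ Q ∈ Fam, P ⊆ Q ∧ Q ≠ P) : S.card ≤ h - 1 := by
  classical
  have gen : ∀ S : Finset (Finset α), (∀ P ∈ S, P ∈ Fam ∧ q ∈ P) → S.card ≤ h := by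
    intro S hS
    have hinj : Set.InjOn Finset.card (S : Set (Finset α)) := by
      intro X hX Y hY hXY
      rcases hL X (hS X hX).1 Y (hS Y hY).1 q (hS X hX).2 (hS Y hY).2 with h' | h'
      · exact Finset.eq_of_subset_of_card_le h' hXY.ge
      · exact (Finset.eq_of_subset_of_card_le h' hXY.le).symm
    have hc : (S.image Finset.card).card = S.card := Finset.card_image_of_injOn hinj
    let e := (S.image Finset.card).orderEmbOfFin hc
    have he : ∀ i, ∃ P ∈ S, P.card = e i := fun i =>
      Finset.mem_image.1 (Finset.orderEmbOfFin_mem _ hc i)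
    choose Q hQ1 hQ2 using he
    refine hheight _ Q (fun i => (hS _ (hQ1 i)).1) ?_
    intro i j hij
    have hlt : (Q i).card < (Q j).card := by
      rw [hQ2, hQ2]
      exact e.strictMono hij
    rcases hL _ (hS _ (hQ1 i)).1 _ (hS _ (hQ1 j)).1 q (hS _ (hQ1 i)).2 (hS _ (hQ1 j)).2
      with h' | h'
    · exact Finset.ssubset_iff_subset_ne.2 ⟨h', fun e' => by rw [e'] at hlt; omega⟩
    · have := Finset.card_le_card h'
      omega
  rcases S.eq_empty_or_nonempty with rfl | ⟨P0, hP0⟩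
  · simp
  obtain ⟨M, hM, hmax⟩ := Finset.exists_max_image (Fam.filter (fun P => q ∈ P)) Finset.card
    ⟨P0, Finset.mem_filter.2 ⟨(hS P0 hP0).1, (hS P0 hP0).2.1⟩⟩
  obtain ⟨hM1, hM2⟩ := Finset.mem_filter.1 hM
  have hMS : M ∉ S := by
    intro hMS
    obtain ⟨-, -, Q, hQ, hs, hn⟩ := hS M hMS
    exact hn (Finset.eq_of_subset_of_card_le hs
      (hmax Q (Finset.mem_filter.2 ⟨hQ, hs hM2⟩))).symm
  have := gen (insert M S) (by
    intro P hP
    rcases Finset.mem_insert.1 hP with rfl | hP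
    · exact ⟨hM1, hM2⟩
    · exact ⟨(hS P hP).1, (hS P hP).2.1⟩)
  rw [Finset.card_insert_of_notMem hMS] at this
  omega

/-- One full time step. -/
theorem step [DecidableEq α] (hL : Lam Fam) (h : ℕ) (h1 : 1 ≤ h)
    (hh : ∀ q : α, ∀ S : Finset (Finset α),
      (∀ P ∈ S, P ∈ Fam ∧ q ∈ P ∧ ∃ Q ∈ Fam, P ⊆ Q ∧ Q ≠ P) → S.card ≤ h - 1)
    {v v' : Finset α → α} {C C' : Finset α} {b : Finset α → Finset α}
    {o : Finset α → α} (I : Inv Fam v C b o) {P : Finset α} (hP : P ∈ hits Fam C')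
    (hv1 : ∀ A ∈ Fam, P ⊆ A → v' A = v P) (hv2 : ∀ A ∈ Fam, ¬ P ⊆ A → v' A = v A) :
    ∃ b' o', Inv Fam v' C' b' o' ∧ v P ∈ sim Fam v' C' b' o' ∧
      (sim Fam v' C' b' o' \ sim Fam v C b o).card + (bots Fam C' b').card + (roots Fam C).card
        ≤ (bots Fam C b).card + (roots Fam C').card + h * (C' \ C).card := by
  classical
  obtain ⟨b1, o1, I1, s1, k1⟩ := evict hL (C' := C ∩ C') I Finset.inter_subset_left
  obtain ⟨b2, o2, I2, s2, k2⟩ := retrieve h hh (C' := C') I1 Finset.inter_subset_right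
  obtain ⟨b3, I3, m3, k3⟩ := request hL I2 hP hv1 hv2
  refine ⟨b3, o2, I3, m3, ?_⟩
  have e : C' \ (C ∩ C') = C' \ C := by
    ext x; simp only [Finset.mem_sdiff, Finset.mem_inter]; tauto
  rw [e] at s2 k2
  have e2 : (sim Fam v' C' b3 o2 \ sim Fam v C b o).card
      ≤ (sim Fam v' C' b3 o2 \ sim Fam v C' b2 o2).card
        + (sim Fam v C' b2 o2 \ sim Fam v (C ∩ C') b1 o1).card := by
    refine le_trans (Finset.card_le_card ?_) (Finset.card_union_le _ _)
    intro x hx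
    obtain ⟨hx1, hx2⟩ := Finset.mem_sdiff.1 hx
    have := fun hx => hx2 (s1 hx)
    simp only [Finset.mem_union, Finset.mem_sdiff]
    tauto
  obtain ⟨h', rfl⟩ : ∃ h', h = h' + 1 := ⟨h - 1, by omega⟩
  simp only [Nat.add_sub_cancel] at k2
  rw [add_mul, one_mul]
  omega

end

/-- The two update rules of the preferred page function. -/
theorem prev_rules {α : Type*} [DecidableEq α]
    (Fam : Finset (Finset α)) (hL : Lam Fam)
    (hne : ∀ P ∈ Fam, P.Nonempty)
    (π : ℕ → Finset α) (T : ℕ) (hπ : ∀ t ∈ Finset.Icc 1 T, π t ∈ Fam)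
    (g : Finset α → α)
    (prev : Finset α → ℕ → α)
    (hprev_base : ∀ P ∈ Fam, ∀ t : ℕ,
      (¬ ∃ i ∈ Finset.Icc 1 t, π i ⊂ P) → prev P t = g P)
    (hprev_step : ∀ P ∈ Fam, ∀ t : ℕ, ∀ i ∈ Finset.Icc 1 t, π i ⊂ P →
      (∀ j ∈ Finset.Icc 1 t, π j ⊂ P → j ≤ i) →
      ∀ c ∈ Fam, π i ⊆ c → c ⊂ P →
        (∀ c' ∈ Fam, π i ⊆ c' → c' ⊂ P → c' ⊆ c) →
        prev P t = prev c t) (t : ℕ) (ht : t + 1 ≤ T) :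
    (∀ A ∈ Fam, π (t + 1) ⊆ A → prev A (t + 1) = prev (π (t + 1)) (t + 1)) ∧
    (∀ A ∈ Fam, ¬ π (t + 1) ⊂ A → prev A (t + 1) = prev A t) := by
  classical
  have child : ∀ i ∈ Finset.Icc 1 T, ∀ A ∈ Fam, π i ⊂ A → ∃ c ∈ Fam, π i ⊆ c ∧ c ⊂ A ∧
      (∀ c' ∈ Fam, π i ⊆ c' → c' ⊂ A → c' ⊆ c) := by
    intro i hi A hA hs
    obtain ⟨x, hx⟩ := hne _ (hπ i hi)
    obtain ⟨c, hc, hmax⟩ := Finset.exists_max_image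
      (Fam.filter (fun c => π i ⊆ c ∧ c ⊂ A)) Finset.card
      ⟨π i, Finset.mem_filter.2 ⟨hπ i hi, Finset.Subset.refl _, hs⟩⟩
    obtain ⟨h1, h2, h3⟩ := Finset.mem_filter.1 hc
    refine ⟨c, h1, h2, h3, fun c' h1' h2' h3' => ?_⟩
    rcases hL c h1 c' h1' x (h2 hx) (h2' hx) with h | h
    · rw [Finset.eq_of_subset_of_card_le h (hmax c' (Finset.mem_filter.2 ⟨h1', h2', h3'⟩))]
    · exact h
  have aux : ∀ n : ℕ, ∀ A ∈ Fam, A.card = n →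
      (π (t + 1) ⊆ A → prev A (t + 1) = prev (π (t + 1)) (t + 1)) ∧
      (¬ π (t + 1) ⊂ A → prev A (t + 1) = prev A t) := by
    intro n
    induction n using Nat.strong_induction_on with
    | _ n ih =>
    intro A hA hn
    constructor
    · intro hs
      by_cases he : π (t + 1) = A
      · rw [he]
      have hss : π (t + 1) ⊂ A := Finset.ssubset_iff_subset_ne.2 ⟨hs, he⟩
      obtain ⟨c, c1, c2, c3, c4⟩ := child (t + 1) (Finset.mem_Icc.2 ⟨by omega, ht⟩) A hA hss
      rw [hprev_step A hA (t + 1) (t + 1) (Finset.mem_Icc.2 ⟨by omega, le_rfl⟩) hss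
        (fun j hj _ => (Finset.mem_Icc.1 hj).2) c c1 c2 c3 c4]
      exact (ih c.card (hn ▸ Finset.card_lt_card c3) c c1 rfl).1 c2
    · intro hs
      by_cases hex : ∃ i ∈ Finset.Icc 1 t, π i ⊂ A
      · obtain ⟨i0, hi0, hi0'⟩ := hex
        obtain ⟨i, hi, hmax⟩ := Finset.exists_max_image
          ((Finset.Icc 1 t).filter (fun i => π i ⊂ A)) id
          ⟨i0, Finset.mem_filter.2 ⟨hi0, hi0'⟩⟩
        obtain ⟨hi1, hi2⟩ := Finset.mem_filter.1 hi
        obtain ⟨hi3, hi4⟩ := Finset.mem_Icc.1 hi1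
        obtain ⟨c, c1, c2, c3, c4⟩ := child i (Finset.mem_Icc.2 ⟨hi3, by omega⟩) A hA hi2
        rw [hprev_step A hA t i hi1 hi2
          (fun j hj hj' => hmax j (Finset.mem_filter.2 ⟨hj, hj'⟩)) c c1 c2 c3 c4]
        rw [hprev_step A hA (t + 1) i (Finset.mem_Icc.2 ⟨hi3, by omega⟩) hi2 (by
          intro j hj hj'
          obtain ⟨hj1, hj2⟩ := Finset.mem_Icc.1 hj
          by_cases hjt : j = t + 1
          · exact absurd (hjt ▸ hj') hs
          · exact hmax j (Finset.mem_filter.2 ⟨Finset.mem_Icc.2 ⟨hj1, by omega⟩, hj'⟩))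
          c c1 c2 c3 c4]
        exact (ih c.card (hn ▸ Finset.card_lt_card c3) c c1 rfl).2
          (fun h => hs (h.trans c3))
      · rw [hprev_base A hA t hex, hprev_base A hA (t + 1)]
        rintro ⟨j, hj, hj'⟩
        obtain ⟨hj1, hj2⟩ := Finset.mem_Icc.1 hj
        by_cases hjt : j = t + 1
        · exact hs (hjt ▸ hj')
        · exact hex ⟨j, Finset.mem_Icc.2 ⟨hj1, by omega⟩, hj'⟩
  exact ⟨fun A hA => (aux _ A hA rfl).1, fun A hA => (aux _ A hA rfl).2⟩

end PLP

/-- **Theorem.** Let `Fam` be a finite laminar family of nonempty page sets of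
height `h`, let `π` be a Page-Laminar Paging request sequence over `Fam`, fix a
choice function `g` with `g P ∈ P` for all `P ∈ Fam`, and let
`prev : Fam × ℕ → pages` be the preferred-page function determined by `π` and `g`:
- if no request `π i` with `1 ≤ i ≤ t` is a proper subset of `P`, then
  `prev P t = g P`;
- otherwise, letting `i` be the largest index in `[1, t]` with `π i ⊊ P` and `c`
  the (unique) maximal member of `Fam` with `π i ⊆ c ⊊ P`, `prev P t = prev c t`.
Then the standard Paging sequence `σ t = prev (π t) t` satisfies
`opt(σ) ≤ h · opt(π)`. -/
theorem page_laminar_reduction {α : Type*} [DecidableEq α]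
    (k h : ℕ) (hk : 1 ≤ k)
    (Fam : Finset (Finset α))
    (hne : ∀ P ∈ Fam, P.Nonempty)
    (hlam : ∀ P ∈ Fam, ∀ P' ∈ Fam, P ∩ P' = ∅ ∨ P ⊆ P' ∨ P' ⊆ P)
    (hheight : ∀ (r : ℕ) (Q : Fin r → Finset α),
      (∀ i, Q i ∈ Fam) → StrictMono Q → r ≤ h)
    (π : ℕ → Finset α) (T : ℕ) (hπ : ∀ t ∈ Finset.Icc 1 T, π t ∈ Fam)
    (g : Finset α → α) (hg : ∀ P ∈ Fam, g P ∈ P)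
    (prev : Finset α → ℕ → α)
    (hprev_base : ∀ P ∈ Fam, ∀ t : ℕ,
      (¬ ∃ i ∈ Finset.Icc 1 t, π i ⊂ P) → prev P t = g P)
    (hprev_step : ∀ P ∈ Fam, ∀ t : ℕ, ∀ i ∈ Finset.Icc 1 t, π i ⊂ P →
      (∀ j ∈ Finset.Icc 1 t, π j ⊂ P → j ≤ i) →
      ∀ c ∈ Fam, π i ⊆ c → c ⊂ P →
        (∀ c' ∈ Fam, π i ⊆ c' → c' ⊂ P → c' ⊆ c) →
        prev P t = prev c t) :
    optSet k (fun t => {prev (π t) t}) T ≤ h * optSet k π T := by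
  classical
  have hL : PLP.Lam Fam := by
    intro P hP Q hQ q h1 h2
    rcases hlam P hP Q hQ with h' | h'
    · have : q ∈ P ∩ Q := Finset.mem_inter.2 ⟨h1, h2⟩
      rw [h'] at this
      exact absurd this (Finset.notMem_empty q)
    · exact h'
  have hrules := PLP.prev_rules Fam hL hne π T hπ g prev hprev_base hprev_step
  -- an optimal solution for `π`
  have hnonempty : { c | ∃ C : ℕ → Finset α, C 0 = ∅ ∧ (∀ t, (C t).card ≤ k) ∧
      (∀ t ∈ Finset.Icc 1 T, (C t ∩ π t).Nonempty) ∧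
      c = ∑ t ∈ Finset.Icc 1 T, (C t \ C (t - 1)).card }.Nonempty := by
    refine ⟨_, fun t => if t ∈ Finset.Icc 1 T then {g (π t)} else ∅, ?_, ?_, ?_, rfl⟩
    · simp
    · intro t
      dsimp only
      split_ifs
      · simpa using hk
      · simp
    · intro t ht
      refine ⟨g (π t), ?_⟩
      simp only [if_pos ht]
      exact Finset.mem_inter.2 ⟨Finset.mem_singleton_self _, hg _ (hπ t ht)⟩
  obtain ⟨C, hC0, hCk, hCπ, hCc⟩ := Nat.sInf_mem hnonempty
  have hopt : optSet k π T = ∑ t ∈ Finset.Icc 1 T, (C t \ C (t - 1)).card := hCc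
  rw [hopt]
  have main : ∀ n ≤ T, ∃ (D : ℕ → Finset α) (b : Finset α → Finset α) (o : Finset α → α),
      D 0 = ∅ ∧ (∀ t, (D t).card ≤ k) ∧
      (∀ t ∈ Finset.Icc 1 n, prev (π t) t ∈ D t) ∧
      PLP.Inv Fam (fun P => prev P n) (C n) b o ∧
      D n = PLP.sim Fam (fun P => prev P n) (C n) b o ∧
      ∑ t ∈ Finset.Icc 1 n, (D t \ D (t - 1)).card + (PLP.bots Fam (C n) b).card
        ≤ h * ∑ t ∈ Finset.Icc 1 n, (C t \ C (t - 1)).card + (PLP.roots Fam (C n)).card := by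
    intro n
    induction n with
    | zero =>
      intro _
      have hh0 : PLP.hits Fam (C 0) = ∅ := by
        rw [Finset.eq_empty_iff_forall_notMem]
        intro P hP
        obtain ⟨-, q, hq, -⟩ := PLP.mem_hits.1 hP
        rw [hC0] at hq
        exact Finset.notMem_empty q hq
      refine ⟨fun _ => ∅, id, g, rfl, by simp, by simp, ?_, ?_, ?_⟩
      · constructor <;> simp [hh0]
      · simp [PLP.sim, PLP.tops, PLP.bots, hh0]
      · simp [PLP.bots, hh0]
    | succ n ih =>
      intro hn
      obtain ⟨D, b, o, hD0, hDk, hDσ, I, hDn, hcost⟩ := ih (by omega)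
      have hmem : n + 1 ∈ Finset.Icc 1 T := Finset.mem_Icc.2 ⟨by omega, hn⟩
      have hPF := hπ _ hmem
      have hhit : π (n + 1) ∈ PLP.hits Fam (C (n + 1)) := by
        obtain ⟨x, hx⟩ := hCπ _ hmem
        obtain ⟨hx1, hx2⟩ := Finset.mem_inter.1 hx
        exact PLP.mem_hits.2 ⟨hPF, x, hx1, hx2⟩
      have h1 : 1 ≤ h := hheight 1 (fun _ => π (n + 1)) (fun _ => hPF)
        (fun i j hij => absurd hij (by simp [Subsingleton.elim i j]))
      obtain ⟨r1, r2⟩ := hrules n hn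
      have hPP : prev (π (n + 1)) (n + 1) = prev (π (n + 1)) n :=
        r2 _ hPF (fun h' => h'.2 h'.1)
      obtain ⟨b', o', I', hm', hc'⟩ := PLP.step hL h h1 (PLP.chain_bound hL h hheight)
        (v' := fun P => prev P (n + 1)) I hhit
        (fun A hA hs => (r1 A hA hs).trans hPP)
        (fun A hA hs => r2 A hA (fun h' => hs h'.1))
      set E := PLP.sim Fam (fun P => prev P (n + 1)) (C (n + 1)) b' o' with hE
      have hlow : ∀ t, t ≤ n → Function.update D (n + 1) E t = D t := fun t ht =>
        Function.update_of_ne (by omega) _ _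
      refine ⟨Function.update D (n + 1) E, b', o', ?_, ?_, ?_, I', ?_, ?_⟩
      · rw [hlow 0 (by omega), hD0]
      · intro t
        by_cases ht : t = n + 1
        · subst ht
          rw [Function.update_self]
          exact (PLP.sim_card I').trans (hCk _)
        · rw [Function.update_of_ne ht]
          exact hDk t
      · intro t ht
        obtain ⟨ht1, ht2⟩ := Finset.mem_Icc.1 ht
        by_cases ht : t = n + 1
        · subst ht
          rw [Function.update_self, hPP]
          exact hm'
        · rw [Function.update_of_ne ht]
          exact hDσ t (Finset.mem_Icc.2 ⟨ht1, by omega⟩)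
      · rw [Function.update_self]
      · rw [Finset.sum_Icc_succ_top (by omega), Finset.sum_Icc_succ_top (by omega)]
        have hs : ∑ t ∈ Finset.Icc 1 n, (Function.update D (n + 1) E t \
            Function.update D (n + 1) E (t - 1)).card
            = ∑ t ∈ Finset.Icc 1 n, (D t \ D (t - 1)).card := by
          refine Finset.sum_congr rfl fun t ht => ?_
          obtain ⟨ht1, ht2⟩ := Finset.mem_Icc.1 ht
          rw [hlow t ht2, hlow (t - 1) (by omega)]
        rw [hs, Function.update_self, Nat.add_sub_cancel, hlow n le_rfl, hDn, mul_add]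
        omega
  obtain ⟨D, b, o, hD0, hDk, hDσ, I, hDn, hcost⟩ := main T le_rfl
  obtain ⟨b', o', I', -, hfin⟩ := PLP.evict hL I (Finset.empty_subset (C T))
  have hr0 : PLP.roots Fam (∅ : Finset α) = ∅ := by
    rw [Finset.eq_empty_iff_forall_notMem]
    intro P hP
    obtain ⟨-, q, hq, -⟩ := PLP.mem_hits.1 (PLP.mem_roots.1 hP).1
    exact Finset.notMem_empty q hq
  rw [hr0, Finset.card_empty] at hfin
  have hle : optSet k (fun t => {prev (π t) t}) T
      ≤ ∑ t ∈ Finset.Icc 1 T, (D t \ D (t - 1)).card := by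
    refine Nat.sInf_le ⟨D, hD0, hDk, ?_, rfl⟩
    intro t ht
    exact ⟨prev (π t) t, Finset.mem_inter.2 ⟨hDσ t ht, Finset.mem_singleton_self _⟩⟩
  omega
end

section
/- Let F be a laminar family of nonempty subsets of [k] and R a finite set of requests over F. Then R is satisfiable (some configuration satisfies R) if and only if for every S ∈ F, the number of requests (p,S') ∈ rep(R) with S' ⊆ S is at most |S|. -/
/-! Slot-Laminar Paging: a finite request set is satisfiable iff the `rep` counting condition holds. -/

/-- A cache configuration: each of the `k` slots holds a page (`some p`) or is
empty. -/
abbrev SConfig (k : ℕ) (α : Type*) := Fin k → Option α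

/-- Slot `s` satisfies request `(p, S)` in configuration `C` if `s ∈ S` and slot
`s` holds page `p`. -/
def SlotSat {k : ℕ} {α : Type*} (C : SConfig k α) (s : Fin k)
    (r : α × Finset (Fin k)) : Prop :=
  s ∈ r.2 ∧ C s = some r.1

/-- A configuration satisfies a request if some slot satisfies it. -/
def RSat {k : ℕ} {α : Type*} (C : SConfig k α) (r : α × Finset (Fin k)) : Prop :=
  ∃ s, SlotSat C s r

/-- A configuration satisfies a set of requests if it satisfies every member. -/
def SetRSat {k : ℕ} {α : Type*} (C : SConfig k α)
    (R : Set (α × Finset (Fin k))) : Prop :=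
  ∀ r ∈ R, RSat C r

/-- `rep R`: the requests of `R` having no proper descendant in `R`. -/
def rep {k : ℕ} {α : Type*} (R : Set (α × Finset (Fin k))) :
    Set (α × Finset (Fin k)) :=
  { r ∈ R | ¬ ∃ S' : Finset (Fin k), S' ⊂ r.2 ∧ (r.1, S') ∈ R }

/-- A family of slot sets is laminar if any two members are disjoint or nested. -/
def Laminar {k : ℕ} (F : Set (Finset (Fin k))) : Prop :=
  ∀ S ∈ F, ∀ S' ∈ F, S ∩ S' = ∅ ∨ S ⊆ S' ∨ S' ⊆ S

/-- **Theorem.** Let `F` be a laminar family of nonempty subsets of `[k]` and `R`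
a finite set of requests over `F`. Then `R` is satisfiable (some configuration
satisfies `R`) if and only if for every `S ∈ F`, the number of requests
`(p, S') ∈ rep R` with `S' ⊆ S` is at most `|S|`. -/
theorem satisfiable_iff_rep_counts {k : ℕ} {α : Type*}
    (F : Set (Finset (Fin k))) (hlam : Laminar F) (hne : ∀ S ∈ F, S.Nonempty)
    (R : Set (α × Finset (Fin k))) (hfin : R.Finite) (hR : ∀ r ∈ R, r.2 ∈ F) :
    (∃ C : SConfig k α, SetRSat C R) ↔
      ∀ S ∈ F, {r ∈ rep R | r.2 ⊆ S}.ncard ≤ S.card := by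
  classical
  have hrepR : rep R ⊆ R := fun r hr => hr.1
  have hrfin : (rep R).Finite := hfin.subset hrepR
  constructor
  · rintro ⟨C, hC⟩ S hS
    have hC' : ∀ r : α × Finset (Fin k), ∃ s, r ∈ R → SlotSat C s r := by
      intro r
      by_cases hr : r ∈ R
      · obtain ⟨s, hs⟩ := hC r hr
        exact ⟨s, fun _ => hs⟩
      · obtain ⟨s, -⟩ := hne S hS
        exact ⟨s, fun h => absurd h hr⟩
    choose f hf using hC'
    rw [← Set.ncard_coe_finset S]
    refine Set.ncard_le_ncard_of_injOn f ?_ ?_ (Finset.finite_toSet S)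
    · rintro r ⟨hr, hrS⟩
      exact hrS (hf r hr.1).1
    · rintro ⟨p, A⟩ ⟨hr, -⟩ ⟨q, B⟩ ⟨hr', -⟩ h
      obtain ⟨h1, h2⟩ := hf _ hr.1
      obtain ⟨h3, h4⟩ := hf _ hr'.1
      rw [← h] at h3 h4
      have hpq : p = q := by
        rw [h2] at h4
        exact Option.some.inj h4
      subst hpq
      have hAB : A = B := by
        rcases hlam A (hR _ hr.1) B (hR _ hr'.1) with h0 | h0 | h0
        · have := Finset.mem_inter.2 ⟨h1, h3⟩
          rw [h0] at this
          simp at this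
        · by_contra hn
          exact hr'.2 ⟨A, lt_of_le_of_ne h0 hn, hr.1⟩
        · by_contra hn
          exact hr.2 ⟨B, lt_of_le_of_ne h0 (Ne.symm hn), hr'.1⟩
      rw [hAB]
  · intro H
    have hall : ∀ A : Finset (rep R), A.card ≤ (A.biUnion fun r => r.1.2).card := by
      intro A
      let T : Finset (Finset (Fin k)) := A.image fun r => r.1.2
      let M : Finset (Finset (Fin k)) := T.filter fun S => Maximal (· ∈ T) S
      have hTF : ∀ S ∈ T, S ∈ F := by
        intro S hS
        obtain ⟨r, -, rfl⟩ := Finset.mem_image.1 hS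
        exact hR _ (hrepR r.2)
      have hM : ∀ S ∈ M, S ∈ T ∧ Maximal (· ∈ T) S := fun S hS => Finset.mem_filter.1 hS
      have hcov : A ⊆ M.biUnion fun S => A.filter fun r => r.1.2 ⊆ S := by
        intro r hr
        have hrT : r.1.2 ∈ T := Finset.mem_image_of_mem _ hr
        obtain ⟨S, hle, hS⟩ := T.exists_le_maximal hrT
        exact Finset.mem_biUnion.2
          ⟨S, Finset.mem_filter.2 ⟨hS.1, hS⟩, Finset.mem_filter.2 ⟨hr, hle⟩⟩
      calc A.card ≤ (M.biUnion fun S => A.filter fun r => r.1.2 ⊆ S).card :=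
            Finset.card_le_card hcov
        _ ≤ ∑ S ∈ M, (A.filter fun r => r.1.2 ⊆ S).card := Finset.card_biUnion_le
        _ ≤ ∑ S ∈ M, S.card := by
            refine Finset.sum_le_sum fun S hS => ?_
            refine le_trans ?_ (H S (hTF S (hM S hS).1))
            rw [← Finset.card_map (Function.Embedding.subtype _), ← Set.ncard_coe_finset]
            refine Set.ncard_le_ncard ?_ (hrfin.subset fun r hr => hr.1)
            intro r hr
            obtain ⟨x, hx, rfl⟩ := Finset.mem_map.1 (Finset.mem_coe.1 hr)
            exact ⟨x.2, (Finset.mem_filter.1 hx).2⟩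
        _ = (M.biUnion id).card := by
            symm
            apply Finset.card_biUnion
            intro S hS S' hS' hn
            have h1 := hM S hS
            have h2 := hM S' hS'
            rcases hlam S (hTF S h1.1) S' (hTF S' h2.1) with h0 | h0 | h0
            · exact Finset.disjoint_iff_inter_eq_empty.2 h0
            · exact absurd (le_antisymm h0 (h1.2.2 h2.1 h0)) hn
            · exact absurd (le_antisymm (h2.2.2 h1.1 h0) h0) hn
        _ ≤ (A.biUnion fun r => r.1.2).card := by
            apply Finset.card_le_card
            intro s hs
            obtain ⟨S, hS, hsS⟩ := Finset.mem_biUnion.1 hs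
            obtain ⟨r, hr, rfl⟩ := Finset.mem_image.1 (hM S hS).1
            exact Finset.mem_biUnion.2 ⟨r, hr, hsS⟩
    obtain ⟨f, hinj, hf⟩ :=
      (Finset.all_card_le_biUnion_card_iff_exists_injective fun r : rep R => r.1.2).1 hall
    refine ⟨fun s => if h : ∃ r, f r = s then some h.choose.1.1 else none, ?_⟩
    have hrep : ∀ (n : ℕ) (p : α) (S : Finset (Fin k)), S.card = n → (p, S) ∈ R →
        ∃ S', S' ⊆ S ∧ (p, S') ∈ rep R := by
      intro n
      induction n using Nat.strong_induction_on with
      | _ n ih =>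
        intro p S hn hS
        by_cases hex : ∃ S' : Finset (Fin k), S' ⊂ S ∧ (p, S') ∈ R
        · obtain ⟨S', h1, h2⟩ := hex
          obtain ⟨S'', h3, h4⟩ := ih S'.card (hn ▸ Finset.card_lt_card h1) p S' rfl h2
          exact ⟨S'', h3.trans h1.1, h4⟩
        · exact ⟨S, subset_rfl, hS, hex⟩
    rintro ⟨p, S⟩ hr
    obtain ⟨S', hsub, hS'⟩ := hrep _ p S rfl hr
    refine ⟨f ⟨_, hS'⟩, hsub (hf ⟨_, hS'⟩), ?_⟩
    have hex : ∃ r, f r = f ⟨_, hS'⟩ := ⟨_, rfl⟩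
    have heq := hinj hex.choose_spec
    show (if h : ∃ r, f r = f ⟨_, hS'⟩ then some h.choose.1.1 else none) = some p
    rw [dif_pos hex, heq]
end

section
/- Let F be a laminar family of nonempty subsets of [k], let R be a finite set of requests over F, let D be an R-configuration, and let r = (p,S) be a request with S ∈ F such that D does not satisfy r and R ∪ {r} is satisfiable. Then there is a slot s ∈ S that is either free in D, or satisfies in D some request (p',S') ∈ rep(R) with S ⊊ S'. -/
/-- `D` is an `R`-configuration: `D` satisfies `R` and each request of `rep R` is
satisfied by exactly one slot of `D`. -/
def IsRConfig {k : ℕ} {α : Type*} (D : SConfig k α)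
    (R : Set (α × Finset (Fin k))) : Prop :=
  SetRSat D R ∧ ∀ r ∈ rep R, ∃! s : Fin k, SlotSat D s r

/-- Slot `s` is free in the `R`-configuration `D`: it satisfies no request of
`rep R`. -/
def FreeSlot {k : ℕ} {α : Type*} (D : SConfig k α)
    (R : Set (α × Finset (Fin k))) (s : Fin k) : Prop :=
  ¬ ∃ r ∈ rep R, SlotSat D s r

/-- **Theorem.** Let `F` be a laminar family of nonempty subsets of `[k]`, `R` a
finite set of requests over `F`, `D` an `R`-configuration, and `r = (p, S)` a
request with `S ∈ F` such that `D` does not satisfy `r` and `R ∪ {r}` is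
satisfiable. Then some slot `s ∈ S` is either free in `D`, or satisfies in `D`
some request `(p', S') ∈ rep R` with `S ⊊ S'`. -/
theorem free_or_higher_slot_exists {k : ℕ} {α : Type*}
    (F : Set (Finset (Fin k))) (hlam : Laminar F) (hne : ∀ S ∈ F, S.Nonempty)
    (R : Set (α × Finset (Fin k))) (hfin : R.Finite) (hR : ∀ r ∈ R, r.2 ∈ F)
    (D : SConfig k α) (hD : IsRConfig D R)
    (p : α) (S : Finset (Fin k)) (hS : S ∈ F)
    (hnsat : ¬ RSat D (p, S))
    (hsat : ∃ C : SConfig k α, SetRSat C (R ∪ {(p, S)})) :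
    ∃ s ∈ S, FreeSlot D R s ∨
      ∃ p' S', (p', S') ∈ rep R ∧ SlotSat D s (p', S') ∧ S ⊂ S' := by
  by_contra hcon
  push Not at hcon
  obtain ⟨C, hC⟩ := hsat
  have h1 : ∀ s : S, ∃ q ∈ rep R, SlotSat D s.1 q ∧ q.2 ⊆ S := by
    rintro ⟨s, hs⟩
    obtain ⟨hf, hh⟩ := hcon s hs
    obtain ⟨q, hq, hsq⟩ : ∃ r ∈ rep R, SlotSat D s r := by
      by_contra h
      exact hf h
    refine ⟨q, hq, hsq, ?_⟩
    rcases hlam S hS q.2 (hR q hq.1) with h | h | h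
    · have : s ∈ S ∩ q.2 := Finset.mem_inter.2 ⟨hs, hsq.1⟩
      simp [h] at this
    · by_contra h'
      exact hh q.1 q.2 hq hsq ⟨h, h'⟩
    · exact h
  choose q hq hqs hqS using h1
  have h2 : ∀ s : S, ∃ t, SlotSat C t (q s) := fun s => hC _ (Or.inl (hq s).1)
  choose t ht using h2
  let g : S → S := fun s => ⟨t s, hqS s (ht s).1⟩
  have hg : Function.Injective g := by
    intro a b hab
    have hab' : t a = t b := congrArg Subtype.val hab
    have ha := ht a
    have hb := ht b
    rw [← hab'] at hb
    have hp : (q a).1 = (q b).1 := Option.some.inj (ha.2.symm.trans hb.2)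
    have hS2 : (q a).2 = (q b).2 := by
      rcases hlam _ (hR _ (hq a).1) _ (hR _ (hq b).1) with h | h | h
      · have : t a ∈ (q a).2 ∩ (q b).2 := Finset.mem_inter.2 ⟨ha.1, hb.1⟩
        simp [h] at this
      · by_contra hn
        exact (hq b).2 ⟨(q a).2, h.ssubset_of_ne hn, by rw [← hp]; exact (hq a).1⟩
      · by_contra hn
        exact (hq a).2 ⟨(q b).2, h.ssubset_of_ne (Ne.symm hn), by rw [hp]; exact (hq b).1⟩
    have hqq : q a = q b := Prod.ext hp hS2
    have hbs := hqs b
    rw [← hqq] at hbs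
    exact Subtype.ext ((hD.2 _ (hq a)).unique (hqs a) hbs)
  obtain ⟨u, hu⟩ := hC (p, S) (Or.inr rfl)
  obtain ⟨s, hs⟩ := (Finite.injective_iff_surjective.1 hg) ⟨u, hu.1⟩
  have hs' : t s = u := congrArg Subtype.val hs
  have hts := (ht s).2
  rw [hs', hu.2] at hts
  exact hnsat ⟨s.1, s.2, (hqs s).2.trans hts.symm⟩
end

section
/- Let F be a laminar family of nonempty subsets of [k], let R be a finite set of requests over F, let D be an R-configuration, and let r = (p_0,S_0) be a request with S_0 ∈ F such that D does not satisfy r and R ∪ {r} is satisfiable. Then there exist an integer m ≥ 1, slots s_1,…,s_m ∈ [k], sets S_0 ⊊ S_1 ⊊ … ⊊ S_{m−1} with S_1,…,S_{m−1} ∈ F, and pages p_1,…,p_{m−1} such that: (i) for each 1 ≤ i < m, s_i ∈ S_{i−1} and s_i satisfies in D a request (p_i,S_i) ∈ rep(R); and (ii) s_m ∈ S_{m−1}, and either s_m is free in D, or m ≥ 2 and s_m satisfies in D a request (p_0,S') ∈ rep(R) with S_{m−2} ⊊ S'. Moreover, the configuration D' defined by D'(s_i) = p_{i−1} for 1 ≤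 i ≤ m and D'(s) = D(s) for all other slots s satisfies R ∪ {r}. -/
theorem rep_eq_of_mem {k : ℕ} {α : Type*} {F : Set (Finset (Fin k))} (hlam : Laminar F)
    {R : Set (α × Finset (Fin k))} (hR : ∀ r ∈ R, r.2 ∈ F)
    {q q' : α × Finset (Fin k)} (hq : q ∈ rep R) (hq' : q' ∈ rep R)
    (hp : q.1 = q'.1) {t : Fin k} (ht : t ∈ q.2) (ht' : t ∈ q'.2) : q = q' := by
  obtain ⟨p, S⟩ := q
  obtain ⟨p', S'⟩ := q'
  simp only at hp ht ht'
  subst hp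
  have key : S = S' := by
    rcases hlam S (hR _ hq.1) S' (hR _ hq'.1) with h | h | h
    · have : t ∈ S ∩ S' := Finset.mem_inter.2 ⟨ht, ht'⟩
      rw [h] at this
      simp at this
    · by_contra hne
      exact hq'.2 ⟨S, lt_of_le_of_ne h hne, hq.1⟩
    · by_contra hne
      exact hq.2 ⟨S', lt_of_le_of_ne h (Ne.symm hne), hq'.1⟩
  rw [key]

theorem exists_rep_below {k : ℕ} {α : Type*} {R : Set (α × Finset (Fin k))} (p : α) :
    ∀ (n : ℕ) (S : Finset (Fin k)), S.card ≤ n → (p, S) ∈ R →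
      ∃ T, T ⊆ S ∧ (p, T) ∈ rep R := by
  intro n
  induction n with
  | zero =>
    intro S hc hS
    refine ⟨S, subset_rfl, hS, ?_⟩
    rintro ⟨S', h, -⟩
    have := Finset.card_lt_card h
    simp only at this
    omega
  | succ n ih =>
    intro S hc hS
    by_cases h : ∃ S', S' ⊂ S ∧ (p, S') ∈ R
    · obtain ⟨S', h1, h2⟩ := h
      have := Finset.card_lt_card h1
      obtain ⟨T, hT, hr⟩ := ih S' (by omega) h2
      exact ⟨T, hT.trans h1.1, hr⟩
    · exact ⟨S, subset_rfl, hS, h⟩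

/-- Slot `t` holds the page `p₀` for a request that becomes redundant. -/
def BadSlot {k : ℕ} {α : Type*} (D : SConfig k α) (R : Set (α × Finset (Fin k)))
    (p₀ : α) (S₀ : Finset (Fin k)) (t : Fin k) : Prop :=
  ∃ S', (p₀, S') ∈ rep R ∧ SlotSat D t (p₀, S') ∧ S₀ ⊂ S'

/-- Counting step: some slot of `A` has a request not contained in `A`. -/
theorem hall_step {k : ℕ} {α : Type*} {F : Set (Finset (Fin k))} (hlam : Laminar F)
    {R : Set (α × Finset (Fin k))} (hR : ∀ r ∈ R, r.2 ∈ F)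
    {D : SConfig k α} {p₀ : α} {S₀ : Finset (Fin k)} (hS₀ : S₀ ∈ F)
    (hD : IsRConfig D R)
    (hnsat : ¬ RSat D (p₀, S₀))
    (hsat : ∃ C : SConfig k α, SetRSat C (R ∪ {(p₀, S₀)}))
    (A : Finset (Fin k)) (hA : S₀ ⊆ A)
    (hfree : ∀ t ∈ A, ¬ FreeSlot D R t) (hbad : ∀ t ∈ A, ¬ BadSlot D R p₀ S₀ t) :
    ∃ t ∈ A, ∃ q ∈ rep R, SlotSat D t q ∧ ¬ q.2 ⊆ A := by
  by_contra hcon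
  push Not at hcon
  have h1 : ∀ t : A, ∃ q, q ∈ rep R ∧ SlotSat D t.1 q := by
    intro t
    have := hfree t.1 t.2
    unfold FreeSlot at this
    push Not at this
    exact this
  choose q hq hqs using h1
  obtain ⟨C, hC⟩ := hsat
  have h2 : ∀ t : A, ∃ u, SlotSat C u (q t) := fun t => hC _ (Or.inl (hq t).1)
  choose g hg using h2
  obtain ⟨u₀, hu₀⟩ := hC (p₀, S₀) (Or.inr rfl)
  have hgA : ∀ t : A, g t ∈ A := fun t =>
    hcon t.1 t.2 (q t) (hq t) (hqs t) (hg t).1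
  have hu₀A : u₀ ∈ A := hA hu₀.1
  have hginj : ∀ t t' : A, g t = g t' → t = t' := by
    intro t t' h
    have e1 := (hg t).2
    have e2 := (hg t').2
    rw [h, e2] at e1
    have hp : (q t).1 = (q t').1 := (Option.some.inj e1).symm
    have m1 := (hg t).1
    have m2 := (hg t').1
    rw [← h] at m2
    have hqq := rep_eq_of_mem hlam hR (hq t) (hq t') hp m1 m2
    have a := hqs t
    have b := hqs t'
    rw [← hqq] at b
    exact Subtype.ext ((hD.2 _ (hq t)).unique a b)
  have hg0 : ∀ t : A, g t ≠ u₀ := by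
    intro t h
    have e1 := (hg t).2
    have m1 := (hg t).1
    rw [h] at e1 m1
    have e2 := hu₀.2
    have m2 := hu₀.1
    simp only at e2 m2
    rw [e2] at e1
    have hp : p₀ = (q t).1 := Option.some.inj e1
    have hqt : q t = (p₀, (q t).2) := by rw [hp]
    have hs := hqs t
    rcases hlam S₀ hS₀ (q t).2 (hR _ (hq t).1) with h | h | h
    · have : u₀ ∈ S₀ ∩ (q t).2 := Finset.mem_inter.2 ⟨m2, m1⟩
      rw [h] at this
      simp at this
    · by_cases he : S₀ = (q t).2
      · apply hnsat
        refine ⟨t.1, ?_⟩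
        rw [he, ← hqt]
        exact hs
      · refine hbad t.1 t.2 ⟨(q t).2, ?_, ?_, lt_of_le_of_ne h he⟩
        · rw [← hqt]; exact hq t
        · rw [← hqt]; exact hs
    · apply hnsat
      refine ⟨t.1, h hs.1, ?_⟩
      rw [hs.2, hp]
  have hinj : Function.Injective
      (fun o : Option A => (o.elim (⟨u₀, hu₀A⟩ : A) (fun t => ⟨g t, hgA t⟩))) := by
    rintro (_ | t) (_ | t') h
    · rfl
    · exact absurd (congrArg Subtype.val h).symm (hg0 t')
    · exact absurd (congrArg Subtype.val h) (hg0 t)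
    · rw [hginj t t' (congrArg Subtype.val h)]
  have := Fintype.card_le_of_injective _ hinj
  simp at this

/-- Partial rotation sequence with `n` displaced requests. -/
structure RotChain {k : ℕ} {α : Type*} (F : Set (Finset (Fin k)))
    (R : Set (α × Finset (Fin k))) (D : SConfig k α) (p₀ : α) (S₀ : Finset (Fin k))
    (n : ℕ) (s : ℕ → Fin k) (Sf : ℕ → Finset (Fin k)) (pf : ℕ → α) : Prop where
  S0 : Sf 0 = S₀
  p0 : pf 0 = p₀
  mono : ∀ i, i < n → Sf i ⊂ Sf (i + 1)
  mem : ∀ i, i ≤ n → Sf i ∈ F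
  slot : ∀ i, i < n → s (i + 1) ∈ Sf i ∧ (pf (i + 1), Sf (i + 1)) ∈ rep R ∧
    SlotSat D (s (i + 1)) (pf (i + 1), Sf (i + 1))
  nobad : ∀ i, i < n → ∀ t ∈ Sf i, ¬ BadSlot D R p₀ S₀ t

theorem RotChain.card_le {k : ℕ} {α : Type*} {F : Set (Finset (Fin k))}
    {R : Set (α × Finset (Fin k))} {D : SConfig k α} {p₀ : α} {S₀ : Finset (Fin k)}
    {n : ℕ} {s : ℕ → Fin k} {Sf : ℕ → Finset (Fin k)} {pf : ℕ → α}
    (h : RotChain F R D p₀ S₀ n s Sf pf) : ∀ i, i ≤ n → i ≤ (Sf i).card := by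
  intro i
  induction i with
  | zero => intro _; omega
  | succ i ih =>
    intro hi
    have := Finset.card_lt_card (h.mono i (by omega))
    have := ih (by omega)
    omega

theorem RotChain.sub {k : ℕ} {α : Type*} {F : Set (Finset (Fin k))}
    {R : Set (α × Finset (Fin k))} {D : SConfig k α} {p₀ : α} {S₀ : Finset (Fin k)}
    {n : ℕ} {s : ℕ → Fin k} {Sf : ℕ → Finset (Fin k)} {pf : ℕ → α}
    (h : RotChain F R D p₀ S₀ n s Sf pf) (i : ℕ) :
    ∀ d, i + d ≤ n → Sf i ⊆ Sf (i + d) ∧ (0 < d → Sf i ⊂ Sf (i + d)) := by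
  intro d
  induction d with
  | zero => intro _; exact ⟨subset_rfl, fun h => absurd h (by omega)⟩
  | succ d ih =>
    intro hd
    have h1 := (ih (by omega)).1
    have h2 := h.mono (i + d) (by omega)
    have h3 : Sf i ⊂ Sf (i + (d + 1)) := lt_of_le_of_lt h1 h2
    exact ⟨h3.1, fun _ => h3⟩

/-- A chain that cannot be terminated can be extended. -/
theorem RotChain.extend {k : ℕ} {α : Type*} {F : Set (Finset (Fin k))} (hlam : Laminar F)
    {R : Set (α × Finset (Fin k))} (hR : ∀ r ∈ R, r.2 ∈ F)
    {D : SConfig k α} {p₀ : α} {S₀ : Finset (Fin k)} (hS₀ : S₀ ∈ F)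
    (hD : IsRConfig D R)
    (hnsat : ¬ RSat D (p₀, S₀))
    (hsat : ∃ C : SConfig k α, SetRSat C (R ∪ {(p₀, S₀)}))
    {n : ℕ} {s : ℕ → Fin k} {Sf : ℕ → Finset (Fin k)} {pf : ℕ → α}
    (h : RotChain F R D p₀ S₀ n s Sf pf)
    (hfree : ∀ t ∈ Sf n, ¬ FreeSlot D R t) (hbad : ∀ t ∈ Sf n, ¬ BadSlot D R p₀ S₀ t) :
    ∃ s Sf pf, RotChain F R D p₀ S₀ (n + 1) s Sf pf := by
  have hsub : S₀ ⊆ Sf n := by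
    have := (h.sub 0 n (by omega)).1
    rwa [h.S0, Nat.zero_add] at this
  obtain ⟨t, ht, ⟨p, T⟩, hq, hqs, hqn⟩ :=
    hall_step hlam hR hS₀ hD hnsat hsat (Sf n) hsub hfree hbad
  have hss : Sf n ⊂ T := by
    rcases hlam (Sf n) (h.mem n le_rfl) T (hR _ hq.1) with h' | h' | h'
    · have : t ∈ Sf n ∩ T := Finset.mem_inter.2 ⟨ht, hqs.1⟩
      rw [h'] at this
      simp at this
    · exact ⟨h', hqn⟩
    · exact absurd h' hqn
  refine ⟨fun i => if i ≤ n then s i else t, fun i => if i ≤ n then Sf i else T,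
    fun i => if i ≤ n then pf i else p, ?_, ?_, ?_, ?_, ?_, ?_⟩
  · simp [h.S0]
  · simp [h.p0]
  · intro i hi
    rcases Nat.lt_succ_iff_lt_or_eq.1 hi with hi' | rfl
    · simpa [hi'.le, Nat.succ_le_of_lt hi'] using h.mono i hi'
    · simpa using hss
  · intro i hi
    by_cases hi' : i ≤ n
    · simpa [hi'] using h.mem i hi'
    · simpa [hi'] using hR _ hq.1
  · intro i hi
    rcases Nat.lt_succ_iff_lt_or_eq.1 hi with hi' | rfl
    · simpa [hi'.le, Nat.succ_le_of_lt hi'] using h.slot i hi'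
    · simpa using ⟨ht, hq, hqs⟩
  · intro i hi
    rcases Nat.lt_succ_iff_lt_or_eq.1 hi with hi' | rfl
    · simpa [hi'.le] using h.nobad i hi'
    · simpa using hbad

/-- **Theorem.** Let `F` be a laminar family of nonempty subsets of `[k]`, `R` a
finite set of requests over `F`, `D` an `R`-configuration, and `r = (p₀, S₀)` a
request with `S₀ ∈ F` such that `D` does not satisfy `r` and `R ∪ {r}` is
satisfiable. Then there are `m ≥ 1`, slots `s 1, …, s m`, sets
`S₀ = Sf 0 ⊊ Sf 1 ⊊ ⋯ ⊊ Sf (m-1)` with `Sf 1, …, Sf (m-1) ∈ F`, and pages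
`p₀ = pf 0, pf 1, …, pf (m-1)` such that:
(i) for `1 ≤ i < m`, `s i ∈ Sf (i-1)` and `s i` satisfies in `D` the request
`(pf i, Sf i) ∈ rep R`;
(ii) `s m ∈ Sf (m-1)` and either `s m` is free in `D`, or `m ≥ 2` and `s m`
satisfies in `D` a request `(p₀, S') ∈ rep R` with `Sf (m-2) ⊊ S'`.
Moreover, the configuration `D'` obtained from `D` by placing page `pf (i-1)` in
slot `s i` for `1 ≤ i ≤ m` (and leaving all other slots unchanged) satisfies
`R ∪ {r}`. -/
theorem rotation_sequence_exists {k : ℕ} {α : Type*}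
    (F : Set (Finset (Fin k))) (hlam : Laminar F) (hne : ∀ S ∈ F, S.Nonempty)
    (R : Set (α × Finset (Fin k))) (hfin : R.Finite) (hR : ∀ r ∈ R, r.2 ∈ F)
    (D : SConfig k α) (hD : IsRConfig D R)
    (p₀ : α) (S₀ : Finset (Fin k)) (hS₀ : S₀ ∈ F)
    (hnsat : ¬ RSat D (p₀, S₀))
    (hsat : ∃ C : SConfig k α, SetRSat C (R ∪ {(p₀, S₀)})) :
    ∃ m : ℕ, 1 ≤ m ∧
      ∃ (s : ℕ → Fin k) (Sf : ℕ → Finset (Fin k)) (pf : ℕ → α),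
        Sf 0 = S₀ ∧ pf 0 = p₀ ∧
        (∀ i, i + 1 ≤ m - 1 → Sf i ⊂ Sf (i + 1)) ∧
        (∀ i, 1 ≤ i → i ≤ m - 1 → Sf i ∈ F) ∧
        (∀ i, 1 ≤ i → i < m →
          s i ∈ Sf (i - 1) ∧ (pf i, Sf i) ∈ rep R ∧
            SlotSat D (s i) (pf i, Sf i)) ∧
        s m ∈ Sf (m - 1) ∧
        (FreeSlot D R (s m) ∨
          (2 ≤ m ∧ ∃ S' : Finset (Fin k), (p₀, S') ∈ rep R ∧
            SlotSat D (s m) (p₀, S') ∧ Sf (m - 2) ⊂ S')) ∧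
        ∃ D' : SConfig k α,
          (∀ i, 1 ≤ i → i ≤ m → D' (s i) = some (pf (i - 1))) ∧
          (∀ t : Fin k, (∀ i, 1 ≤ i → i ≤ m → s i ≠ t) → D' t = D t) ∧
          SetRSat D' (R ∪ {(p₀, S₀)}) := by
  classical
  have hex : ∃ n s Sf pf, RotChain F R D p₀ S₀ n s Sf pf ∧
      ∃ t ∈ Sf n, FreeSlot D R t ∨ BadSlot D R p₀ S₀ t := by
    by_contra hcon
    have hall : ∀ n, ∃ s Sf pf, RotChain F R D p₀ S₀ n s Sf pf := by
      intro n
      induction n with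
      | zero =>
        obtain ⟨a, ha⟩ := hne S₀ hS₀
        refine ⟨fun _ => a, fun _ => S₀, fun _ => p₀, rfl, rfl, ?_, fun _ _ => hS₀, ?_, ?_⟩ <;>
          · intro i hi; omega
      | succ n ih =>
        obtain ⟨s, Sf, pf, h⟩ := ih
        refine h.extend hlam hR hS₀ hD hnsat hsat ?_ ?_
        · intro t ht hf
          exact hcon ⟨n, s, Sf, pf, h, t, ht, Or.inl hf⟩
        · intro t ht hf
          exact hcon ⟨n, s, Sf, pf, h, t, ht, Or.inr hf⟩
    obtain ⟨s, Sf, pf, h⟩ := hall (k + 1)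
    have h1 := h.card_le (k + 1) le_rfl
    have h2 := Finset.card_le_univ (Sf (k + 1))
    simp only [Fintype.card_fin] at h2
    omega
  obtain ⟨n, s₁, Sf, pf, h, t, ht, hterm⟩ := hex
  obtain ⟨s, hsn, hslt⟩ : ∃ s : ℕ → Fin k, s (n + 1) = t ∧ ∀ i, i ≤ n → s i = s₁ i :=
    ⟨fun i => if i ≤ n then s₁ i else t, by simp, fun i hi => by simp [hi]⟩
  have hslot : ∀ i, i < n → s (i + 1) ∈ Sf i ∧ (pf (i + 1), Sf (i + 1)) ∈ rep R ∧
      SlotSat D (s (i + 1)) (pf (i + 1), Sf (i + 1)) := by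
    intro i hi
    rw [hslt (i + 1) (by omega)]
    exact h.slot i hi
  -- distinctness of the slots
  have hlast : ∀ i, i < n → s (i + 1) ≠ t := by
    intro i hi he
    obtain ⟨a, b, c⟩ := hslot i hi
    rcases hterm with hf | hb
    · exact hf ⟨_, b, he ▸ c⟩
    · exact h.nobad i hi t (he ▸ a) hb
  have hmid : ∀ i j, i < j → j < n → s (i + 1) ≠ s (j + 1) := by
    intro i j hij hj he
    obtain ⟨-, b, c⟩ := hslot i (by omega)
    obtain ⟨-, b', c'⟩ := hslot j hj
    rw [← he] at c'
    have hp : pf (i + 1) = pf (j + 1) := by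
      have e := c.2
      rw [c'.2] at e
      exact (Option.some.inj e).symm
    have heq := congrArg Prod.snd (rep_eq_of_mem hlam hR b b' hp c.1 c'.1)
    simp only at heq
    have hs := (h.sub (i + 1) (j - i) (by omega)).2 (by omega)
    rw [show i + 1 + (j - i) = j + 1 by omega, heq] at hs
    exact hs.2 subset_rfl
  have hlt : ∀ i j, i < j → j ≤ n → s (i + 1) ≠ s (j + 1) := by
    intro i j hij hj
    rcases Nat.lt_or_eq_of_le hj with hj' | rfl
    · exact hmid i j hij hj'
    · rw [hsn]; exact hlast i hij
  have hinj : ∀ i j, i ≤ n → j ≤ n → s (i + 1) = s (j + 1) → i = j := by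
    intro i j hi hj he
    rcases lt_trichotomy i j with h' | h' | h'
    · exact absurd he (hlt i j h' hj)
    · exact h'
    · exact absurd he.symm (hlt j i h' hi)
  obtain ⟨D', hD'1, hD'2⟩ : ∃ D' : SConfig k α,
      (∀ i, i ≤ n → D' (s (i + 1)) = some (pf i)) ∧
      (∀ u, (∀ i, i ≤ n → s (i + 1) ≠ u) → D' u = D u) := by
    refine ⟨fun u => if hu : ∃ i, i ≤ n ∧ s (i + 1) = u then some (pf hu.choose) else D u,
      ?_, ?_⟩
    · intro i hi
      have hu : ∃ j, j ≤ n ∧ s (j + 1) = s (i + 1) := ⟨i, hi, rfl⟩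
      have e := hinj _ _ hu.choose_spec.1 hi hu.choose_spec.2
      simp only [dif_pos hu]
      rw [e]
    · intro u hu
      have hu' : ¬ ∃ i, i ≤ n ∧ s (i + 1) = u := by
        rintro ⟨i, hi, e⟩
        exact hu i hi e
      simp only [dif_neg hu']
  have hmemAll : ∀ i, i ≤ n → s (i + 1) ∈ Sf i := by
    intro i hi
    rcases Nat.lt_or_eq_of_le hi with hi' | rfl
    · exact (hslot i hi').1
    · rw [hsn]; exact ht
  have hr0 : SlotSat D' (s 1) (p₀, S₀) := by
    refine ⟨?_, ?_⟩
    · have := hmemAll 0 (by omega)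
      rwa [h.S0] at this
    · have := hD'1 0 (by omega)
      rwa [h.p0] at this
  have hrep : ∀ q ∈ rep R, RSat D' q := by
    intro q hq
    obtain ⟨u, hu, -⟩ := hD.2 q hq
    by_cases hm : ∃ i, i ≤ n ∧ s (i + 1) = u
    · obtain ⟨i, hi, rfl⟩ := hm
      rcases Nat.lt_or_eq_of_le hi with hi' | rfl
      · obtain ⟨-, b, c⟩ := hslot i hi'
        have hp : q.1 = pf (i + 1) := by
          have e := c.2
          rw [hu.2] at e
          exact Option.some.inj e
        have e := rep_eq_of_mem hlam hR hq b hp hu.1 c.1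
        rw [e]
        exact ⟨s (i + 1 + 1), hmemAll (i + 1) hi', hD'1 (i + 1) hi'⟩
      · rw [hsn] at hu
        rcases hterm with hf | ⟨S', b, c, d⟩
        · exact absurd ⟨q, hq, hu⟩ hf
        · have hp : q.1 = p₀ := by
            have e := c.2
            rw [hu.2] at e
            exact Option.some.inj e
          have e := rep_eq_of_mem hlam hR hq b hp hu.1 c.1
          rw [e]
          exact ⟨s 1, d.1 hr0.1, hr0.2⟩
    · refine ⟨u, hu.1, ?_⟩
      rw [hD'2 u (fun i hi e => hm ⟨i, hi, e⟩)]
      exact hu.2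
  refine ⟨n + 1, by omega, s, Sf, pf, h.S0, h.p0, ?_, ?_, ?_, ?_, ?_, D', ?_, ?_, ?_⟩
  · intro i hi
    exact h.mono i (by omega)
  · intro i _ hi
    exact h.mem i (by omega)
  · intro i h1 h2
    obtain ⟨j, rfl⟩ : ∃ j, i = j + 1 := ⟨i - 1, by omega⟩
    exact hslot j (by omega)
  · exact hmemAll n le_rfl
  · rw [hsn]
    rcases hterm with hf | hb
    · exact Or.inl hf
    · right
      have hn : n ≠ 0 := by
        rintro rfl
        obtain ⟨S', b, c, d⟩ := hb
        rw [h.S0] at ht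
        exact hnsat ⟨t, ht, c.2⟩
      obtain ⟨j, rfl⟩ : ∃ j, n = j + 1 := ⟨n - 1, by omega⟩
      refine ⟨by omega, ?_⟩
      have hnb := h.nobad j (by omega)
      have hb' := hb
      obtain ⟨S', b, c, d⟩ := hb
      refine ⟨S', b, c, ?_⟩
      change Sf j ⊂ S'
      have hns : ¬ S' ⊆ Sf j := fun hs => hnb t (hs c.1) hb'
      rcases hlam (Sf j) (h.mem j (by omega)) S' (hR _ b.1) with h' | h' | h'
      · obtain ⟨a, ha⟩ := hne S₀ hS₀
        have h0 := (h.sub 0 j (by omega)).1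
        rw [h.S0, Nat.zero_add] at h0
        have : a ∈ Sf j ∩ S' := Finset.mem_inter.2 ⟨h0 ha, d.1 ha⟩
        rw [h'] at this
        simp at this
      · exact ⟨h', hns⟩
      · exact absurd h' hns
  · intro i h1 h2
    obtain ⟨j, rfl⟩ : ∃ j, i = j + 1 := ⟨i - 1, by omega⟩
    exact hD'1 j (by omega)
  · intro u hu
    exact hD'2 u (fun i hi => hu (i + 1) (by omega) (by omega))
  · rintro ⟨p, S⟩ (hq | hq)
    · obtain ⟨T, hT, hTr⟩ := exists_rep_below p S.card S le_rfl hq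
      obtain ⟨u, hu1, hu2⟩ := hrep _ hTr
      exact ⟨u, hT hu1, hu2⟩
    · rw [Set.mem_singleton_iff] at hq
      rw [hq]
      exact ⟨s 1, hr0⟩
end
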